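/- arXiv:2106.04296 — 3 statements merged into one kernel-verified Lean document; each statement's English description precedes it below -/
import Mathlib

section
/- Fixed μ with 0 < μ < 2 and η > 0: there exists a constant M > 0 such that |E_{μ,η}(-t)| ≤ M / (1 + t) for all t ≥ 0. -/
open Real

noncomputable def mittagLeffler (μ η z : ℝ) : ℝ := ∑' n : ℕ, z ^ n / Real.Gamma (μ * n + η)

open MeasureTheory Set Filter Topology

theorem rpow_mul_exp_neg_le_Gamma {s A : ℝ} (hs : 1 ≤ s) (hA : 0 < A) :
    A ^ (s - 1) * rexp (-A) ≤ Real.Gamma s := by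
  have hint := Real.GammaIntegral_convergent (zero_lt_one.trans_le hs)
  rw [Real.Gamma_eq_integral (zero_lt_one.trans_le hs)]
  calc A ^ (s - 1) * rexp (-A) = ∫ x in Ioi A, rexp (-x) * A ^ (s - 1) := by
        rw [integral_mul_const, integral_exp_neg_Ioi, mul_comm]
    _ ≤ ∫ x in Ioi A, rexp (-x) * x ^ (s - 1) := by
        refine setIntegral_mono_on ((integrableOn_exp_neg_Ioi A).mul_const _)
          (hint.mono_set (Ioi_subset_Ioi hA.le)) measurableSet_Ioi fun x hx ↦ ?_
        have : A ^ (s - 1) ≤ x ^ (s - 1) :=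
          Real.rpow_le_rpow hA.le (le_of_lt hx) (by linarith)
        gcongr
    _ ≤ ∫ x in Ioi 0, rexp (-x) * x ^ (s - 1) := by
        refine setIntegral_mono_set hint ?_ (Ioi_subset_Ioi hA.le).eventuallyLE
        filter_upwards [ae_restrict_mem measurableSet_Ioi] with x hx
        have : (0:ℝ) < x := hx
        simp only [Pi.zero_apply]
        positivity

theorem summable_pow_div_Gamma {μ : ℝ} (hμ : 0 < μ) (η : ℝ) {R : ℝ} (hR : 0 ≤ R) :
    Summable fun n : ℕ ↦ R ^ n / Real.Gamma (μ * n + η) := by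
  set A : ℝ := (2 * R + 1) ^ (1 / μ) with hAdef
  have hA : 0 < A := by positivity
  have hAμ : A ^ μ = 2 * R + 1 := by
    rw [hAdef, ← Real.rpow_mul (by positivity), one_div_mul_cancel hμ.ne', Real.rpow_one]
  have hgeo : Summable fun n : ℕ ↦ rexp A * A ^ (1 - η) * (R / (2 * R + 1)) ^ n :=
    (summable_geometric_of_lt_one (by positivity)
      ((div_lt_one (by positivity)).2 (by linarith))).mul_left _
  refine Summable.of_norm_bounded_eventually_nat hgeo ?_
  have hlim : Tendsto (fun n : ℕ ↦ μ * n + η) atTop atTop :=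
    tendsto_atTop_add_const_right _ _ (tendsto_natCast_atTop_atTop.const_mul_atTop hμ)
  filter_upwards [hlim.eventually_ge_atTop 1] with n hn
  have hle := rpow_mul_exp_neg_le_Gamma hn hA
  have hpos : 0 < A ^ (μ * n + η - 1) * rexp (-A) := by positivity
  rw [Real.norm_of_nonneg (div_nonneg (by positivity) (hpos.le.trans hle))]
  calc R ^ n / Real.Gamma (μ * n + η) ≤ R ^ n / (A ^ (μ * n + η - 1) * rexp (-A)) := by gcongr
    _ = _ := by
        rw [show μ * n + η - 1 = μ * n - (1 - η) by ring, Real.rpow_sub hA, Real.rpow_mul hA.le,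
          hAμ, Real.rpow_natCast, Real.exp_neg, div_pow]
        field_simp

/-- The Laplace transform of `x ↦ x ^ (s - 1)` on the right half-plane. -/
theorem integral_rpow_mul_cexp_neg_mul_Ioi {s : ℝ} (hs : 0 < s) {w : ℂ} (hw : 0 < w.re) :
    ∫ x in Ioi (0 : ℝ), ((x ^ (s - 1) : ℝ) : ℂ) * Complex.exp (-(w * x)) =
      Real.Gamma s * w ^ ((-s : ℝ) : ℂ) := by
  set U : Set ℂ := {w | 0 < w.re} with hU
  have hUo : IsOpen U := isOpen_lt continuous_const Complex.continuous_re
  have hmeas (r : ℝ) (w : ℂ) : AEStronglyMeasurable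
      (fun x : ℝ ↦ ((x ^ r : ℝ) : ℂ) * Complex.exp (-(w * x))) (volume.restrict (Ioi 0)) := by
    apply Measurable.aestronglyMeasurable
    fun_prop
  have hreal {r δ : ℝ} (hr : 0 < r) (hδ : 0 < δ) :
      IntegrableOn (fun x : ℝ ↦ x ^ (r - 1) * rexp (-(δ * x))) (Ioi 0) := by
    have := integrableOn_rpow_mul_exp_neg_mul_rpow (s := r - 1) (p := 1) (b := δ)
      (by linarith) one_pos hδ
    simpa using this
  have hnorm {r δ : ℝ} {w : ℂ} (hw : δ ≤ w.re) {x : ℝ} (hx : 0 < x) :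
      ‖((x ^ r : ℝ) : ℂ) * Complex.exp (-(w * x))‖ ≤ x ^ r * rexp (-(δ * x)) := by
    have : 0 ≤ x ^ r := by positivity
    rw [norm_mul, Complex.norm_real, Real.norm_of_nonneg this, Complex.norm_exp]
    simp only [Complex.neg_re, Complex.re_mul_ofReal]
    gcongr
  have hd : DifferentiableOn ℂ (fun w : ℂ ↦
      ∫ x in Ioi (0 : ℝ), ((x ^ (s - 1) : ℝ) : ℂ) * Complex.exp (-(w * x))) U := by
    intro w hw
    have hw : 0 < w.re := hw
    have hwn : {z : ℂ | w.re / 2 < z.re} ∈ 𝓝 w :=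
      (isOpen_lt continuous_const Complex.continuous_re).mem_nhds (by simp; linarith)
    refine (hasDerivAt_integral_of_dominated_loc_of_deriv_le
      (F' := fun w x ↦ -(((x ^ s : ℝ) : ℂ) * Complex.exp (-(w * x))))
      (bound := fun x ↦ x ^ s * rexp (-(w.re / 2 * x)))
      hwn (.of_forall fun z ↦ hmeas _ z) ?_ (hmeas _ _).neg ?_ ?_
      ?_).2.differentiableAt.differentiableWithinAt
    · refine (hreal hs hw).mono' (hmeas _ _) ?_
      filter_upwards [ae_restrict_mem measurableSet_Ioi] with x hx using hnorm le_rfl hx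
    · filter_upwards [ae_restrict_mem measurableSet_Ioi] with x hx z hz
      rw [norm_neg]
      exact hnorm (le_of_lt hz) hx
    · have := hreal (r := s + 1) (by linarith) (half_pos hw)
      rwa [add_sub_cancel_right] at this
    · filter_upwards [ae_restrict_mem measurableSet_Ioi] with x hx z hz
      have hx : 0 < x := hx
      have h1 : HasDerivAt (fun z : ℂ ↦ -(z * x)) (-(x : ℂ)) z := by
        simpa only [one_mul] using (hasDerivAt_mul_const (x : ℂ)).fun_neg
      refine (h1.cexp.const_mul (((x ^ (s - 1) : ℝ) : ℂ))).congr_deriv ?_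
      have : x ^ s = x ^ (s - 1) * x := by rw [← Real.rpow_add_one hx.ne', sub_add_cancel]
      rw [this]
      push_cast
      ring
  have hg : DifferentiableOn ℂ (fun w : ℂ ↦ (Real.Gamma s : ℂ) * w ^ ((-s : ℝ) : ℂ)) U := by
    intro w hw
    exact ((differentiableAt_id.cpow_const (Or.inl hw)).const_mul _).differentiableWithinAt
  have heq : EqOn _ _ U := (hd.analyticOnNhd hUo).eqOn_of_preconnected_of_frequently_eq
    (hg.analyticOnNhd hUo) (convex_halfSpace_re_gt 0).isPreconnected (z₀ := 1) (by simp [hU]) (by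
      have ht : Tendsto (fun r : ℝ ↦ (r : ℂ)) (𝓝[>] 1) (𝓝[≠] 1) := by
        refine tendsto_nhdsWithin_iff.2 ⟨?_, ?_⟩
        · exact (Complex.continuous_ofReal.tendsto' 1 1 (by simp)).mono_left nhdsWithin_le_nhds
        · filter_upwards [self_mem_nhdsWithin] with r hr
          have : r ≠ 1 := ne_of_gt hr
          simpa using this
      refine ht.frequently (Eventually.frequently ?_)
      filter_upwards [self_mem_nhdsWithin] with r hr
      have hr : 0 < r := zero_lt_one.trans hr
      have := Real.integral_rpow_mul_exp_neg_mul_Ioi hs hr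
      rw [← Complex.ofReal_cpow hr.le, ← Complex.ofReal_mul, Real.rpow_neg hr.le,
        ← Real.inv_rpow hr.le, mul_comm, ← one_div, ← this, ← integral_complex_ofReal]
      push_cast
      rfl)
  exact heq hw

/-- A parametrization of the vertical line `Re z = 1`. -/
noncomputable def unitVerticalLine (ξ : ℝ) : ℂ := 1 + 2 * π * ξ * Complex.I

theorem unitVerticalLine_re (ξ : ℝ) : (unitVerticalLine ξ).re = 1 := by
  simp [unitVerticalLine]

theorem continuous_unitVerticalLine : Continuous unitVerticalLine := by
  unfold unitVerticalLine
  fun_prop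

theorem unitVerticalLine_mem_slitPlane (ξ : ℝ) : unitVerticalLine ξ ∈ Complex.slitPlane :=
  Or.inl (by rw [unitVerticalLine_re]; exact one_pos)

theorem one_le_norm_unitVerticalLine (ξ : ℝ) : 1 ≤ ‖unitVerticalLine ξ‖ := by
  simpa [unitVerticalLine_re] using Complex.re_le_norm (unitVerticalLine ξ)

theorem one_add_norm_le_norm_unitVerticalLine (ξ : ℝ) :
    (1 + ‖ξ‖) / 2 ≤ ‖unitVerticalLine ξ‖ := by
  have h1 := one_le_norm_unitVerticalLine ξ
  have h2 := Complex.abs_im_le_norm (unitVerticalLine ξ)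
  have h3 : (unitVerticalLine ξ).im = 2 * π * ξ := by simp [unitVerticalLine]
  rw [h3, abs_mul, abs_of_pos (by positivity)] at h2
  have h4 := Real.pi_gt_three
  rw [Real.norm_eq_abs]
  nlinarith [abs_nonneg ξ]

theorem continuous_unitVerticalLine_cpow (a : ℂ) :
    Continuous fun ξ ↦ unitVerticalLine ξ ^ a :=
  continuous_unitVerticalLine.cpow continuous_const unitVerticalLine_mem_slitPlane

theorem integrable_norm_unitVerticalLine_rpow {s : ℝ} (hs : 1 < s) :
    Integrable fun ξ ↦ ‖unitVerticalLine ξ‖ ^ (-s) := by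
  have hi : Integrable (fun ξ : ℝ ↦ (1 + ‖ξ‖) ^ (-s)) :=
    integrable_one_add_norm (by simpa using hs)
  refine (hi.const_mul ((1 / 2 : ℝ) ^ (-s))).mono' ?_ (.of_forall fun ξ ↦ ?_)
  · exact (continuous_unitVerticalLine.norm.measurable.pow_const _).aestronglyMeasurable
  · rw [Real.norm_of_nonneg (by positivity), ← Real.mul_rpow (by positivity) (by positivity)]
    refine Real.rpow_le_rpow_of_nonpos (by positivity) ?_ (by linarith)
    linarith [one_add_norm_le_norm_unitVerticalLine ξ]

theorem norm_exp_mul_unitVerticalLine_cpow (s ξ : ℝ) :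
    ‖Complex.exp (unitVerticalLine ξ) * unitVerticalLine ξ ^ ((-s : ℝ) : ℂ)‖ =
      rexp 1 * ‖unitVerticalLine ξ‖ ^ (-s) := by
  rw [norm_mul, Complex.norm_exp, unitVerticalLine_re, Complex.norm_cpow_real]

theorem continuous_exp_mul_unitVerticalLine_cpow (s : ℝ) : Continuous fun ξ ↦
    Complex.exp (unitVerticalLine ξ) * unitVerticalLine ξ ^ ((-s : ℝ) : ℂ) :=
  continuous_unitVerticalLine.cexp.mul (continuous_unitVerticalLine_cpow _)

theorem integrable_exp_mul_unitVerticalLine_cpow {s : ℝ} (hs : 1 < s) : Integrable fun ξ ↦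
    Complex.exp (unitVerticalLine ξ) * unitVerticalLine ξ ^ ((-s : ℝ) : ℂ) :=
  ((integrable_norm_unitVerticalLine_rpow hs).const_mul (rexp 1)).mono'
    (continuous_exp_mul_unitVerticalLine_cpow s).aestronglyMeasurable
    (.of_forall fun ξ ↦ (norm_exp_mul_unitVerticalLine_cpow s ξ).le)

/-- Bromwich's integral for the reciprocal of the Gamma function. -/
theorem integral_exp_mul_unitVerticalLine_cpow {s : ℝ} (hs : 1 < s) :
    ∫ ξ, Complex.exp (unitVerticalLine ξ) * unitVerticalLine ξ ^ ((-s : ℝ) : ℂ) =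
      1 / Real.Gamma s := by
  have hs0 : 0 < s := by linarith
  set f : ℝ → ℂ := (Ioi (0 : ℝ)).indicator
    fun x ↦ ((x ^ (s - 1) * rexp (-x) : ℝ) : ℂ) with hf
  have hΓ : (Real.Gamma s : ℂ) ≠ 0 := by exact_mod_cast (Real.Gamma_pos_of_pos hs0).ne'
  have hfint : Integrable f := by
    rw [hf, integrable_indicator_iff measurableSet_Ioi]
    refine Integrable.ofReal ?_
    exact (Real.GammaIntegral_convergent hs0).congr (.of_forall fun x ↦ mul_comm _ _)
  have hfour : FourierTransform.fourier f =
      fun ξ ↦ (Real.Gamma s : ℂ) * unitVerticalLine ξ ^ ((-s : ℝ) : ℂ) := by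
    ext ξ
    rw [Real.fourier_real_eq_integral_exp_smul,
      ← integral_rpow_mul_cexp_neg_mul_Ioi hs0 (by rw [unitVerticalLine_re]; exact one_pos),
      ← integral_indicator measurableSet_Ioi]
    congr 1
    ext x
    by_cases hx : x ∈ Ioi (0 : ℝ)
    · simp only [hf, indicator_of_mem hx, smul_eq_mul, unitVerticalLine]
      push_cast
      rw [mul_left_comm, ← Complex.exp_add]
      ring_nf
    · simp [hf, indicator_of_notMem hx]
  have hfourint : Integrable (FourierTransform.fourier f) := by
    rw [hfour]
    refine Integrable.const_mul ?_ _
    refine (integrable_norm_unitVerticalLine_rpow hs).mono'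
      (continuous_unitVerticalLine_cpow _).aestronglyMeasurable (.of_forall fun ξ ↦ ?_)
    rw [Complex.norm_cpow_real]
  have hcont : ContinuousAt f 1 := by
    have : f =ᶠ[𝓝 1] fun x ↦ ((x ^ (s - 1) * rexp (-x) : ℝ) : ℂ) := by
      filter_upwards [Ioi_mem_nhds one_pos] with x hx using indicator_of_mem hx _
    refine ContinuousAt.congr ?_ this.symm
    refine Complex.continuous_ofReal.continuousAt.comp ?_
    exact (Real.continuousAt_rpow_const _ _ (Or.inl one_ne_zero)).mul (by fun_prop)
  have hinv := hfint.fourierInv_fourier_eq hfourint hcont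
  rw [Real.fourierInv_eq', hfour] at hinv
  have hf1 : f 1 = Complex.exp (-1) := by
    simp [hf]
  rw [hf1] at hinv
  have hcalc : ∀ ξ : ℝ, Complex.exp (unitVerticalLine ξ) * unitVerticalLine ξ ^ ((-s : ℝ) : ℂ) =
      Complex.exp 1 / Real.Gamma s * (Complex.exp (((2 * π * inner ℝ ξ 1 : ℝ) : ℂ) * Complex.I) •
        ((Real.Gamma s : ℂ) * unitVerticalLine ξ ^ ((-s : ℝ) : ℂ))) := by
    intro ξ
    have : Complex.exp (unitVerticalLine ξ) =
        Complex.exp 1 * Complex.exp (((2 * π * inner ℝ ξ 1 : ℝ) : ℂ) * Complex.I) := by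
      rw [← Complex.exp_add]
      simp [unitVerticalLine]
    rw [this, smul_eq_mul]
    field_simp
  simp_rw [hcalc]
  rw [integral_const_mul, hinv, div_mul_eq_mul_div, ← Complex.exp_add]
  simp

/-- The Mittag-Leffler function with complex argument, evaluated at `-t`. -/
noncomputable def complexMittagLefflerNeg (μ η : ℝ) (t : ℂ) : ℂ :=
  ∑' n : ℕ, (-t) ^ n / (Real.Gamma (μ * n + η) : ℂ)

theorem complexMittagLefflerNeg_ofReal (μ η t : ℝ) :
    complexMittagLefflerNeg μ η t = mittagLeffler μ η (-t) := by
  simp [complexMittagLefflerNeg, mittagLeffler, Complex.ofReal_tsum]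

section MittagLeffler

variable {μ η : ℝ}

theorem norm_neg_pow_div_Gamma_le (hμ : 0 < μ) (hη : 0 < η) {t : ℂ} {R : ℝ} (ht : ‖t‖ ≤ R)
    (n : ℕ) :
    ‖(-t) ^ n / (Real.Gamma (μ * n + η) : ℂ)‖ ≤ R ^ n / Real.Gamma (μ * n + η) := by
  have hΓ : 0 < Real.Gamma (μ * n + η) := Real.Gamma_pos_of_pos (by positivity)
  rw [norm_div, norm_pow, norm_neg, Complex.norm_real, Real.norm_of_nonneg hΓ.le]
  gcongr

theorem summable_neg_pow_div_Gamma (hμ : 0 < μ) (hη : 0 < η) (t : ℂ) :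
    Summable fun n : ℕ ↦ (-t) ^ n / (Real.Gamma (μ * n + η) : ℂ) :=
  Summable.of_norm_bounded (summable_pow_div_Gamma hμ η (norm_nonneg t))
    (norm_neg_pow_div_Gamma_le hμ hη le_rfl)

theorem differentiableOn_neg_pow_div (c : ℂ) (n : ℕ) (U : Set ℂ) :
    DifferentiableOn ℂ (fun t : ℂ ↦ (-t) ^ n / c) U := by
  fun_prop

theorem differentiable_complexMittagLefflerNeg (hμ : 0 < μ) (hη : 0 < η) :
    Differentiable ℂ (complexMittagLefflerNeg μ η) := by
  intro t
  have hR : 0 ≤ ‖t‖ + 1 := by positivity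
  refine (Complex.differentiableOn_tsum_of_summable_norm (U := Metric.ball 0 (‖t‖ + 1))
    (summable_pow_div_Gamma hμ η hR) (fun n ↦ differentiableOn_neg_pow_div _ n _)
    Metric.isOpen_ball fun n w hw ↦ norm_neg_pow_div_Gamma_le hμ hη ?_ n).differentiableAt
    (Metric.isOpen_ball.mem_nhds (by simp))
  exact (mem_ball_zero_iff.1 hw).le

/-- The relation `E_{μ,η}(z) = η E_{μ,η+1}(z) + μ z E'_{μ,η+1}(z)`. -/
theorem complexMittagLefflerNeg_eq_add_deriv (hμ : 0 < μ) (hη : 0 < η) (t : ℂ) :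
    complexMittagLefflerNeg μ η t = η * complexMittagLefflerNeg μ (η + 1) t +
      μ * t * deriv (complexMittagLefflerNeg μ (η + 1)) t := by
  have hη1 : 0 < η + 1 := by linarith
  have hR : 0 ≤ ‖t‖ + 1 := by positivity
  have hder := Complex.hasSum_deriv_of_summable_norm (U := Metric.ball 0 (‖t‖ + 1)) (z := t)
    (summable_pow_div_Gamma hμ (η + 1) hR) (fun n ↦ differentiableOn_neg_pow_div _ n _)
    Metric.isOpen_ball (fun n w hw ↦ norm_neg_pow_div_Gamma_le hμ hη1
      (mem_ball_zero_iff.1 hw).le n) (by simp)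
  have hsum := ((summable_neg_pow_div_Gamma hμ hη1 t).hasSum.mul_left (η : ℂ)).add
    (hder.mul_left (μ * t : ℂ))
  refine Eq.trans (tsum_congr fun n ↦ ?_) hsum.tsum_eq
  have hpos : 0 < μ * n + η := by positivity
  have hΓ : (Real.Gamma (μ * n + η) : ℂ) ≠ 0 := by
    exact_mod_cast (Real.Gamma_pos_of_pos hpos).ne'
  have hposc : (μ * n + η : ℂ) ≠ 0 := by exact_mod_cast hpos.ne'
  have hd : deriv (fun w : ℂ ↦ (-w) ^ n / (Real.Gamma (μ * n + (η + 1)) : ℂ)) t =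
      n * (-t) ^ (n - 1) * (-1) / (Real.Gamma (μ * n + (η + 1)) : ℂ) :=
    (((hasDerivAt_neg t).fun_pow n).div_const _).deriv
  rw [hd, ← add_assoc, Real.Gamma_add_one hpos.ne']
  push_cast
  rcases n with _ | n
  · have hηc : (η : ℂ) ≠ 0 := by exact_mod_cast hη.ne'
    field_simp
    simp
  · rw [Nat.add_sub_cancel]
    push_cast at hposc ⊢
    field_simp
    ring

end MittagLeffler

/-- The open sector around the positive real axis swept by the discs of centre `r` and
radius `c * r`. -/
def positiveCone (c : ℝ) : Set ℂ := {t | ∃ r : ℝ, 0 < r ∧ ‖t - r‖ < c * r}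

theorem isOpen_positiveCone (c : ℝ) : IsOpen (positiveCone c) := by
  have : positiveCone c = ⋃ r : ℝ, ⋃ _ : 0 < r, Metric.ball (r : ℂ) (c * r) := by
    ext t
    simp [positiveCone, dist_eq_norm]
  rw [this]
  exact isOpen_iUnion fun r ↦ isOpen_iUnion fun _ ↦ Metric.isOpen_ball

theorem convex_positiveCone (c : ℝ) : Convex ℝ (positiveCone c) := by
  rw [convex_iff_forall_pos]
  rintro t ⟨r, hr, htr⟩ u ⟨q, hq, huq⟩ a b ha hb -
  refine ⟨a * r + b * q, by positivity, ?_⟩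
  calc ‖a • t + b • u - ((a * r + b * q : ℝ) : ℂ)‖ = ‖a • (t - r) + b • (u - q)‖ := by
        congr 1
        simp only [Complex.real_smul]
        push_cast
        ring
    _ ≤ a * ‖t - r‖ + b * ‖u - q‖ := by
        refine (norm_add_le _ _).trans_eq ?_
        rw [norm_smul, norm_smul, Real.norm_of_nonneg ha.le, Real.norm_of_nonneg hb.le]
    _ < a * (c * r) + b * (c * q) := by gcongr
    _ = c * (a * r + b * q) := by ring

theorem sqrt_mul_one_add_norm_le_norm_one_add {κ : ℝ} (hκ : κ ≤ 1) {w : ℂ}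
    (hw : κ * ‖w‖ ≤ w.re) : √((1 + κ) / 2) * (1 + ‖w‖) ≤ ‖1 + w‖ := by
  rcases le_total (1 + κ) 0 with h | h
  · rw [Real.sqrt_eq_zero_of_nonpos (by linarith), zero_mul]
    positivity
  refine abs_le_of_sq_le_sq' ?_ (norm_nonneg _) |>.2
  rw [mul_pow, Real.sq_sqrt (by linarith)]
  have h1 : ‖1 + w‖ ^ 2 = 1 + 2 * w.re + ‖w‖ ^ 2 := by
    rw [Complex.sq_norm, Complex.sq_norm, Complex.normSq_apply, Complex.normSq_apply]
    simp
    ring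
  rw [h1]
  nlinarith [mul_nonneg (sub_nonneg.2 hκ) (sq_nonneg (1 - ‖w‖))]

/-- The constant `c` such that `c * (1 + r * ‖z ^ (-μ)‖)` bounds `‖1 + t * z ^ (-μ)‖` from below
on the right half-plane when `‖t - r‖ ≤ c * r`. -/
noncomputable def coneConstant (μ : ℝ) : ℝ := √((1 + Real.cos (μ * (π / 2))) / 2) / 2

theorem coneConstant_pos {μ : ℝ} (hμ0 : 0 < μ) (hμ2 : μ < 2) : 0 < coneConstant μ := by
  have h : Real.cos π < Real.cos (μ * (π / 2)) :=
    Real.cos_lt_cos_of_nonneg_of_le_pi (by positivity) le_rfl (by nlinarith [Real.pi_pos])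
  rw [Real.cos_pi] at h
  have : 0 < (1 + Real.cos (μ * (π / 2))) / 2 := by linarith
  unfold coneConstant
  positivity

theorem cos_mul_norm_cpow_le_re {μ : ℝ} (hμ0 : 0 < μ) (hμ2 : μ < 2) {z : ℂ} (hz : 0 < z.re) :
    Real.cos (μ * (π / 2)) * ‖z ^ ((-μ : ℝ) : ℂ)‖ ≤ (z ^ ((-μ : ℝ) : ℂ)).re := by
  have hz0 : z ≠ 0 := fun h ↦ by simp [h] at hz
  have hre : (z ^ ((-μ : ℝ) : ℂ)).re = ‖z ^ ((-μ : ℝ) : ℂ)‖ * Real.cos (μ * z.arg) := by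
    rw [Complex.norm_cpow_real, Complex.cpow_ofReal_re, mul_neg, Real.cos_neg, mul_comm z.arg]
  rw [hre, mul_comm]
  have harg : |z.arg| ≤ π / 2 := Complex.abs_arg_le_pi_div_two_iff.2 hz.le
  rw [← Real.cos_abs (μ * z.arg), abs_mul, abs_of_pos hμ0]
  refine mul_le_mul_of_nonneg_left ?_ (norm_nonneg _)
  exact Real.cos_le_cos_of_nonneg_of_le_pi (by positivity) (by nlinarith [Real.pi_pos])
    (by gcongr)

theorem coneConstant_mul_le_norm {μ : ℝ} (hμ0 : 0 < μ) (hμ2 : μ < 2) {z : ℂ} (hz : 0 < z.re)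
    {t : ℂ} {r : ℝ} (hr : 0 < r) (ht : ‖t - r‖ ≤ coneConstant μ * r) :
    coneConstant μ * (1 + r * ‖z ^ ((-μ : ℝ) : ℂ)‖) ≤ ‖1 + t * z ^ ((-μ : ℝ) : ℂ)‖ := by
  set v := z ^ ((-μ : ℝ) : ℂ) with hv
  have hrv : ‖(r : ℂ) * v‖ = r * ‖v‖ := by
    rw [norm_mul, Complex.norm_real, Real.norm_of_nonneg hr.le]
  have h1 : 2 * coneConstant μ * (1 + r * ‖v‖) ≤ ‖1 + (r : ℂ) * v‖ := by
    have hcone : 2 * coneConstant μ = √((1 + Real.cos (μ * (π / 2))) / 2) := by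
      unfold coneConstant
      ring
    rw [hcone, ← hrv]
    refine sqrt_mul_one_add_norm_le_norm_one_add (Real.cos_le_one _) ?_
    rw [hrv, Complex.re_ofReal_mul]
    nlinarith [cos_mul_norm_cpow_le_re hμ0 hμ2 hz]
  have h2 : ‖(1 + (r : ℂ) * v)‖ ≤ ‖1 + t * v‖ + ‖t - r‖ * ‖v‖ := by
    rw [← norm_mul, show (1 + (r : ℂ) * v) = (1 + t * v) - (t - r) * v by ring]
    exact norm_sub_le _ _
  have h3 : ‖t - r‖ * ‖v‖ ≤ coneConstant μ * r * ‖v‖ := by gcongr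
  nlinarith [coneConstant_pos hμ0 hμ2]

section Contour

variable {μ η : ℝ}

/-- The integrand of the contour representation of the Mittag-Leffler function. -/
noncomputable def mittagLefflerKernel (μ η : ℝ) (t : ℂ) (ξ : ℝ) : ℂ :=
  Complex.exp (unitVerticalLine ξ) * unitVerticalLine ξ ^ ((-η : ℝ) : ℂ) /
    (1 + t * unitVerticalLine ξ ^ ((-μ : ℝ) : ℂ))

theorem measurable_mittagLefflerKernel (μ η : ℝ) (t : ℂ) :
    Measurable (mittagLefflerKernel μ η t) :=
  (continuous_exp_mul_unitVerticalLine_cpow η).measurable.div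
    ((continuous_unitVerticalLine_cpow _).measurable.const_mul t |>.const_add 1)

theorem norm_mittagLefflerKernel (μ η : ℝ) (t : ℂ) (ξ : ℝ) : ‖mittagLefflerKernel μ η t ξ‖ =
    rexp 1 * ‖unitVerticalLine ξ‖ ^ (-η) / ‖1 + t * unitVerticalLine ξ ^ ((-μ : ℝ) : ℂ)‖ := by
  rw [mittagLefflerKernel, norm_div, norm_exp_mul_unitVerticalLine_cpow]

theorem norm_unitVerticalLine_cpow_neg_le_one (hμ0 : 0 < μ) (ξ : ℝ) :
    ‖unitVerticalLine ξ ^ ((-μ : ℝ) : ℂ)‖ ≤ 1 := by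
  rw [Complex.norm_cpow_real]
  exact Real.rpow_le_one_of_one_le_of_nonpos (one_le_norm_unitVerticalLine ξ) (by linarith)

theorem coneConstant_le_norm_one_add (hμ0 : 0 < μ) (hμ2 : μ < 2) {t : ℂ}
    (ht : t ∈ positiveCone (coneConstant μ)) (ξ : ℝ) :
    coneConstant μ ≤ ‖1 + t * unitVerticalLine ξ ^ ((-μ : ℝ) : ℂ)‖ := by
  obtain ⟨r, hr, htr⟩ := ht
  refine le_trans ?_ (coneConstant_mul_le_norm hμ0 hμ2 (by simp [unitVerticalLine_re]) hr htr.le)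
  exact le_mul_of_one_le_right (coneConstant_pos hμ0 hμ2).le (le_add_of_nonneg_right (by positivity))

theorem differentiableOn_integral_mittagLefflerKernel (hμ0 : 0 < μ) (hμ2 : μ < 2) (hη : 1 < η) :
    DifferentiableOn ℂ (fun t ↦ ∫ ξ, mittagLefflerKernel μ η t ξ)
      (positiveCone (coneConstant μ)) := by
  intro t ht
  have hc := coneConstant_pos hμ0 hμ2
  have hint := (integrable_norm_unitVerticalLine_rpow hη).const_mul (rexp 1)
  refine (hasDerivAt_integral_of_dominated_loc_of_deriv_le
    (F' := fun t ξ ↦ -(mittagLefflerKernel μ η t ξ * unitVerticalLine ξ ^ ((-μ : ℝ) : ℂ) /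
      (1 + t * unitVerticalLine ξ ^ ((-μ : ℝ) : ℂ))))
    (bound := fun ξ ↦ rexp 1 * ‖unitVerticalLine ξ‖ ^ (-η) / coneConstant μ * 1 / coneConstant μ)
    ((isOpen_positiveCone _).mem_nhds ht)
    (.of_forall fun z ↦ (measurable_mittagLefflerKernel μ η z).aestronglyMeasurable)
    ?_ ?_ (.of_forall fun ξ z hz ↦ ?_) ?_
    (.of_forall fun ξ z hz ↦ ?_)).2.differentiableAt.differentiableWithinAt
  · refine (hint.div_const (coneConstant μ)).mono'
      (measurable_mittagLefflerKernel μ η t).aestronglyMeasurable (.of_forall fun ξ ↦ ?_)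
    rw [norm_mittagLefflerKernel]
    have := coneConstant_le_norm_one_add hμ0 hμ2 ht ξ
    gcongr
  · have hv := (continuous_unitVerticalLine_cpow ((-μ : ℝ) : ℂ)).measurable
    exact (((measurable_mittagLefflerKernel μ η t).mul hv).div
      ((hv.const_mul t).const_add 1)).neg.aestronglyMeasurable
  · have := coneConstant_le_norm_one_add hμ0 hμ2 hz ξ
    have := norm_unitVerticalLine_cpow_neg_le_one hμ0 ξ
    rw [norm_neg, norm_div, norm_mul, norm_mittagLefflerKernel]
    gcongr
  · exact ((hint.div_const _).mul_const _).div_const _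
  · have hne : 1 + z * unitVerticalLine ξ ^ ((-μ : ℝ) : ℂ) ≠ 0 :=
      norm_pos_iff.1 (hc.trans_le (coneConstant_le_norm_one_add hμ0 hμ2 hz ξ))
    have h1 : HasDerivAt (fun z : ℂ ↦ 1 + z * unitVerticalLine ξ ^ ((-μ : ℝ) : ℂ))
        (unitVerticalLine ξ ^ ((-μ : ℝ) : ℂ)) z := (hasDerivAt_mul_const _).const_add 1
    refine ((hasDerivAt_const z (Complex.exp (unitVerticalLine ξ) *
      unitVerticalLine ξ ^ ((-η : ℝ) : ℂ))).fun_div h1 hne).congr_deriv ?_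
    unfold mittagLefflerKernel
    field_simp
    ring

theorem integral_mittagLefflerKernel_of_norm_lt_one (hμ0 : 0 < μ) (hη : 1 < η) {t : ℂ}
    (ht : ‖t‖ < 1) :
    ∫ ξ, mittagLefflerKernel μ η t ξ = complexMittagLefflerNeg μ η t := by
  have hs (n : ℕ) : 1 < μ * n + η := by nlinarith [mul_nonneg hμ0.le (Nat.cast_nonneg (α := ℝ) n)]
  set F : ℕ → ℝ → ℂ := fun n ξ ↦ (-t) ^ n *
    (Complex.exp (unitVerticalLine ξ) * unitVerticalLine ξ ^ ((-(μ * n + η) : ℝ) : ℂ)) with hF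
  have hFint (n : ℕ) : Integrable (F n) :=
    (integrable_exp_mul_unitVerticalLine_cpow (hs n)).const_mul _
  have hFnorm (n : ℕ) : ∫ ξ, ‖F n ξ‖ ≤ (∫ ξ, rexp 1 * ‖unitVerticalLine ξ‖ ^ (-η)) * ‖t‖ ^ n := by
    rw [← integral_mul_const]
    refine integral_mono (hFint n).norm
      (((integrable_norm_unitVerticalLine_rpow hη).const_mul _).mul_const _) fun ξ ↦ ?_
    simp only [hF, norm_mul (_ ^ n), norm_pow, norm_neg, norm_exp_mul_unitVerticalLine_cpow]
    rw [mul_comm]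
    gcongr
    · exact one_le_norm_unitVerticalLine ξ
    · nlinarith [mul_nonneg hμ0.le (Nat.cast_nonneg (α := ℝ) n)]
  have hsum : Summable fun n ↦ ∫ ξ, ‖F n ξ‖ :=
    Summable.of_nonneg_of_le (fun n ↦ integral_nonneg fun ξ ↦ norm_nonneg _) hFnorm
      ((summable_geometric_of_lt_one (norm_nonneg t) ht).mul_left _)
  have hF_tsum (ξ : ℝ) : ∑' n, F n ξ = mittagLefflerKernel μ η t ξ := by
    set z := unitVerticalLine ξ with hz
    have hz0 : z ≠ 0 := norm_pos_iff.1 (one_pos.trans_le (one_le_norm_unitVerticalLine ξ))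
    have hlt : ‖-t * z ^ ((-μ : ℝ) : ℂ)‖ < 1 := by
      rw [norm_mul, norm_neg]
      exact mul_lt_one_of_nonneg_of_lt_one_left (norm_nonneg _) ht
        (norm_unitVerticalLine_cpow_neg_le_one hμ0 ξ)
    have hgeo := (hasSum_geometric_of_norm_lt_one hlt).mul_left
      (Complex.exp z * z ^ ((-η : ℝ) : ℂ))
    refine Eq.trans (tsum_congr fun n ↦ ?_) (hgeo.tsum_eq.trans ?_)
    · simp only [hF, ← hz]
      rw [show ((-(μ * n + η) : ℝ) : ℂ) = ((-μ : ℝ) : ℂ) * n + ((-η : ℝ) : ℂ) by push_cast; ring,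
        Complex.cpow_add _ _ hz0, Complex.cpow_mul_nat]
      ring
    · rw [mittagLefflerKernel, ← hz, div_eq_mul_inv]
      congr 2
      ring
  have := (hasSum_integral_of_summable_integral_norm hFint hsum).tsum_eq
  simp_rw [hF_tsum] at this
  rw [← this]
  refine tsum_congr fun n ↦ ?_
  rw [hF, integral_const_mul, integral_exp_mul_unitVerticalLine_cpow (hs n), mul_one_div]

theorem integral_mittagLefflerKernel (hμ0 : 0 < μ) (hμ2 : μ < 2) (hη : 1 < η) {t : ℂ}
    (ht : t ∈ positiveCone (coneConstant μ)) :
    ∫ ξ, mittagLefflerKernel μ η t ξ = complexMittagLefflerNeg μ η t := by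
  have hc := coneConstant_pos hμ0 hμ2
  have hopen := isOpen_positiveCone (coneConstant μ)
  refine ((differentiableOn_integral_mittagLefflerKernel hμ0 hμ2 hη).analyticOnNhd
    hopen).eqOn_of_preconnected_of_eventuallyEq
    ((differentiable_complexMittagLefflerNeg hμ0 (by linarith)).differentiableOn.analyticOnNhd
    hopen) (convex_positiveCone _).isPreconnected (z₀ := ((1 / 2 : ℝ) : ℂ))
    ⟨1 / 2, by norm_num, by simpa using hc⟩ ?_ ht
  filter_upwards [Metric.isOpen_ball.mem_nhds (show ((1 / 2 : ℝ) : ℂ) ∈ Metric.ball 0 1 by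
    rw [mem_ball_zero_iff, Complex.norm_real]; norm_num)] with w hw
  exact integral_mittagLefflerKernel_of_norm_lt_one hμ0 hη (mem_ball_zero_iff.1 hw)

/-- Decay of the Mittag-Leffler function on a sector around the negative real axis. -/
def HasSectorialDecay (μ η : ℝ) : Prop :=
  ∃ c > 0, ∃ M, ∀ r : ℝ, 0 < r → ∀ t : ℂ, ‖t - r‖ ≤ c * r →
    ‖complexMittagLefflerNeg μ η t‖ ≤ M / r

theorem hasSectorialDecay_of_add_one_lt (hμ0 : 0 < μ) (hμ2 : μ < 2) (hη : μ + 1 < η) :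
    HasSectorialDecay μ η := by
  have hc := coneConstant_pos hμ0 hμ2
  have hint := ((integrable_norm_unitVerticalLine_rpow
    (show 1 < η - μ by linarith)).const_mul (rexp 1)).div_const (coneConstant μ)
  refine ⟨coneConstant μ / 2, by positivity,
    ∫ ξ, rexp 1 * ‖unitVerticalLine ξ‖ ^ (-(η - μ)) / coneConstant μ, fun r hr t ht ↦ ?_⟩
  have ht' : ‖t - r‖ < coneConstant μ * r := by nlinarith
  rw [← integral_mittagLefflerKernel hμ0 hμ2 (by linarith) ⟨r, hr, ht'⟩, ← integral_div]
  refine norm_integral_le_of_norm_le (hint.div_const r) (.of_forall fun ξ ↦ ?_)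
  rw [norm_mittagLefflerKernel]
  have hz : 0 < ‖unitVerticalLine ξ‖ := one_pos.trans_le (one_le_norm_unitVerticalLine ξ)
  have hle : coneConstant μ * (r * ‖unitVerticalLine ξ‖ ^ (-μ)) ≤
      ‖1 + t * unitVerticalLine ξ ^ ((-μ : ℝ) : ℂ)‖ := by
    refine le_trans ?_ (coneConstant_mul_le_norm hμ0 hμ2
      (by simp [unitVerticalLine_re]) hr ht'.le)
    rw [Complex.norm_cpow_real]
    gcongr
    linarith
  calc _ ≤ rexp 1 * ‖unitVerticalLine ξ‖ ^ (-η) /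
        (coneConstant μ * (r * ‖unitVerticalLine ξ‖ ^ (-μ))) := by gcongr
    _ = _ := by
        rw [show -(η - μ) = -η - -μ by ring, Real.rpow_sub hz]
        field_simp

theorem HasSectorialDecay.of_add_one (hμ : 0 < μ) (hη : 0 < η)
    (h : HasSectorialDecay μ (η + 1)) : HasSectorialDecay μ η := by
  obtain ⟨c, hc, M, hM⟩ := h
  refine ⟨c / 2, by positivity, η * M + μ * (1 + c / 2) * (M / (c / 2)), fun r hr t ht ↦ ?_⟩
  have hder : ‖deriv (complexMittagLefflerNeg μ (η + 1)) t‖ ≤ M / r / (c / 2 * r) := by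
    refine Complex.norm_deriv_le_of_forall_mem_sphere_norm_le (by positivity)
      (differentiable_complexMittagLefflerNeg hμ (by linarith)).diffContOnCl fun z hz ↦ ?_
    refine hM r hr z ?_
    rw [mem_sphere_iff_norm] at hz
    calc ‖z - r‖ = ‖(z - t) + (t - r)‖ := by ring_nf
      _ ≤ c / 2 * r + c / 2 * r := (norm_add_le _ _).trans (add_le_add hz.le ht)
      _ = c * r := by ring
  have htn : ‖t‖ ≤ (1 + c / 2) * r := by
    calc ‖t‖ = ‖(r : ℂ) + (t - r)‖ := by ring_nf
      _ ≤ r + c / 2 * r := by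
          refine (norm_add_le _ _).trans (add_le_add ?_ ht)
          rw [Complex.norm_real, Real.norm_of_nonneg hr.le]
      _ = (1 + c / 2) * r := by ring
  have hval := hM r hr t (ht.trans (by nlinarith))
  rw [complexMittagLefflerNeg_eq_add_deriv hμ hη]
  calc _ ≤ η * ‖complexMittagLefflerNeg μ (η + 1) t‖ +
        μ * ‖t‖ * ‖deriv (complexMittagLefflerNeg μ (η + 1)) t‖ := by
        refine (norm_add_le _ _).trans_eq ?_
        simp only [norm_mul, Complex.norm_real, Real.norm_of_nonneg hη.le,
          Real.norm_of_nonneg hμ.le]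
    _ ≤ η * (M / r) + μ * ((1 + c / 2) * r) * (M / r / (c / 2 * r)) := by gcongr
    _ = _ := by
        field_simp

theorem hasSectorialDecay (hμ0 : 0 < μ) (hμ2 : μ < 2) (hη : 0 < η) : HasSectorialDecay μ η := by
  have key (k : ℕ) : ∀ η : ℝ, 0 < η → μ + 1 < η + k → HasSectorialDecay μ η := by
    induction k with
    | zero => exact fun η _ h ↦ hasSectorialDecay_of_add_one_lt hμ0 hμ2 (by simpa using h)
    | succ k ih =>
      refine fun η hη h ↦ (ih (η + 1) (by linarith) ?_).of_add_one hμ0 hη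
      push_cast at h
      linarith
  obtain ⟨k, hk⟩ := exists_nat_gt (μ + 1)
  exact key k η hη (by linarith)

theorem exists_forall_le_one_abs_mittagLeffler_le (hμ : 0 < μ) (hη : 0 < η) :
    ∃ M, ∀ t : ℝ, 0 ≤ t → t ≤ 1 → |mittagLeffler μ η (-t)| ≤ M := by
  refine ⟨∑' n : ℕ, 1 ^ n / Real.Gamma (μ * n + η), fun t ht0 ht1 ↦ ?_⟩
  rw [← Real.norm_eq_abs, ← Complex.norm_real, ← complexMittagLefflerNeg_ofReal]
  refine tsum_of_norm_bounded (summable_pow_div_Gamma hμ η zero_le_one).hasSum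
    (norm_neg_pow_div_Gamma_le hμ hη ?_)
  rwa [Complex.norm_real, Real.norm_of_nonneg ht0]

end Contour

theorem mittagLeffler_decay_bound (μ η : ℝ) (hμ0 : 0 < μ) (hμ2 : μ < 2) (hη : 0 < η) :
    ∃ M > 0, ∀ t : ℝ, 0 ≤ t → |mittagLeffler μ η (-t)| ≤ M / (1 + t) := by
  obtain ⟨M₀, hM₀⟩ := exists_forall_le_one_abs_mittagLeffler_le hμ0 hη
  obtain ⟨c, hc, M₁, hM₁⟩ := hasSectorialDecay hμ0 hμ2 hη
  refine ⟨2 * (|M₀| + |M₁| + 1), by positivity, fun t ht ↦ ?_⟩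
  rw [le_div_iff₀ (by positivity)]
  rcases le_or_gt t 1 with h | h
  · have h1 := (hM₀ t ht h).trans (le_abs_self M₀)
    nlinarith [abs_nonneg M₁, abs_nonneg (mittagLeffler μ η (-t))]
  · have ht0 : 0 < t := by linarith
    have h1 := hM₁ t ht0 t (by simpa using by positivity)
    rw [complexMittagLefflerNeg_ofReal, Complex.norm_real, Real.norm_eq_abs,
      le_div_iff₀ ht0] at h1
    nlinarith [abs_nonneg M₀, le_abs_self M₁, abs_nonneg (mittagLeffler μ η (-t))]
end

section
/- For 0 < α < 1, as t → +∞, E_{α,1}(-t) = 1/(t·Γ(1-α)) + O(1/t²); in particular t·E_{α,1}(-t) → 1/Γ(1-α). -/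
open Real Filter Asymptotics

open MeasureTheory Set

/-- Integrability along the path that goes from `b` up to `b + π i` and then right to `∞ + π i`. -/
def HankelIntegrable (b : ℝ) (f : ℂ → ℂ) : Prop :=
  IntervalIntegrable (fun y : ℝ => f (b + y * Complex.I)) volume 0 π ∧
    IntegrableOn (fun x : ℝ => f (x + π * Complex.I)) (Ioi b)

/-- The imaginary part of the integral of `f` along the path that goes from `b` up to `b + π i`
and then right to `∞ + π i`: half of a Hankel contour in the logarithmic coordinate. -/
noncomputable def hankelIntegral (b : ℝ) (f : ℂ → ℂ) : ℝ :=
  (Complex.I * (∫ y in (0 : ℝ)..π, f (b + y * Complex.I)) +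
    ∫ x in Ioi b, f (x + π * Complex.I)).im

/-- The integrand `e^s s^(γ - 1) ds` of the Hankel integral for `1 / Γ (1 - γ)`, with `s = e^w`. -/
noncomputable def hankelKernel (γ : ℝ) (w : ℂ) : ℂ := Complex.exp (Complex.exp w + γ * w)

theorem HankelIntegrable.const_mul {b : ℝ} {f : ℂ → ℂ} (hf : HankelIntegrable b f) (c : ℂ) :
    HankelIntegrable b (fun w => c * f w) :=
  ⟨hf.1.const_mul c, hf.2.const_mul c⟩

theorem hankelIntegral_const_mul (b : ℝ) (f : ℂ → ℂ) (c : ℝ) :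
    hankelIntegral b (fun w => c * f w) = c * hankelIntegral b f := by
  simp only [hankelIntegral, intervalIntegral.integral_const_mul, integral_const_mul]
  rw [← Complex.im_ofReal_mul]
  congr 1
  ring

theorem hankelIntegral_add {b : ℝ} {f g : ℂ → ℂ} (hf : HankelIntegrable b f)
    (hg : HankelIntegrable b g) :
    hankelIntegral b (fun w => f w + g w) = hankelIntegral b f + hankelIntegral b g := by
  simp only [hankelIntegral]
  rw [intervalIntegral.integral_add hf.1 hg.1, integral_add hf.2 hg.2, ← Complex.add_im]
  congr 1
  ring

theorem hankelIntegral_congr {b : ℝ} {f g : ℂ → ℂ}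
    (h : ∀ w : ℂ, 0 ≤ w.im → w.im ≤ π → f w = g w) : hankelIntegral b f = hankelIntegral b g := by
  have h1 : ∫ y in (0 : ℝ)..π, f (b + y * Complex.I) = ∫ y in (0 : ℝ)..π, g (b + y * Complex.I) := by
    refine intervalIntegral.integral_congr fun y hy => ?_
    rw [uIcc_of_le pi_pos.le] at hy
    exact h _ (by simpa using hy.1) (by simpa using hy.2)
  have h2 : ∀ x : ℝ, f (x + π * Complex.I) = g (x + π * Complex.I) := fun x =>
    h _ (by simpa using pi_pos.le) (by simp)
  simp only [hankelIntegral, h1, h2]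

theorem abs_hankelIntegral_le {b C : ℝ} {f g : ℂ → ℂ} (hg : HankelIntegrable b g)
    (h : ∀ w : ℂ, 0 ≤ w.im → w.im ≤ π → ‖f w‖ ≤ C * ‖g w‖) :
    |hankelIntegral b f| ≤ C * ((∫ y in (0 : ℝ)..π, ‖g (b + y * Complex.I)‖) +
      ∫ x in Ioi b, ‖g (x + π * Complex.I)‖) := by
  rw [mul_add, ← intervalIntegral.integral_const_mul, ← integral_const_mul]
  refine (Complex.abs_im_le_norm _).trans ((norm_add_le _ _).trans (add_le_add ?_ ?_))
  · rw [norm_mul, Complex.norm_I, one_mul]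
    refine intervalIntegral.norm_integral_le_of_norm_le pi_pos.le ?_ (hg.1.norm.const_mul C)
    filter_upwards with y hy
    exact h _ (by simpa using hy.1.le) (by simpa using hy.2)
  · refine norm_integral_le_of_norm_le (hg.2.norm.const_mul C) ?_
    filter_upwards with x
    exact h _ (by simpa using pi_pos.le) (by simp)

theorem hasSum_hankelIntegral {b q : ℝ} {f g : ℂ → ℂ} {F : ℕ → ℂ → ℂ} (hg : HankelIntegrable b g)
    (hq0 : 0 ≤ q) (hq1 : q < 1) (hF : ∀ n, HankelIntegrable b (F n))
    (hbound : ∀ n (w : ℂ), b ≤ w.re → ‖F n w‖ ≤ q ^ n * ‖g w‖)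
    (hsum : ∀ w : ℂ, b ≤ w.re → HasSum (fun n => F n w) (f w)) :
    HasSum (fun n => hankelIntegral b (F n)) (hankelIntegral b f) := by
  have hs : Summable fun n : ℕ => q ^ n := summable_geometric_of_lt_one hq0 hq1
  have h1 : HasSum (fun n => ∫ y in (0 : ℝ)..π, F n (b + y * Complex.I))
      (∫ y in (0 : ℝ)..π, f (b + y * Complex.I)) := by
    refine intervalIntegral.hasSum_integral_of_dominated_convergence
      (fun n y => q ^ n * ‖g (b + y * Complex.I)‖) (fun n => ?_) (fun n => ?_) ?_ ?_ ?_
    · have := (hF n).1.aestronglyMeasurable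
      rwa [uIoc_of_le pi_pos.le]
    · filter_upwards with y _
      exact hbound n _ (by simp)
    · filter_upwards with y _
      exact hs.mul_right _
    · simp only [tsum_mul_right]
      exact hg.1.norm.const_mul _
    · filter_upwards with y _
      exact hsum _ (by simp)
  have h2 : HasSum (fun n => ∫ x in Ioi b, F n (x + π * Complex.I))
      (∫ x in Ioi b, f (x + π * Complex.I)) := by
    refine MeasureTheory.hasSum_integral_of_dominated_convergence
      (fun n x => q ^ n * ‖g (x + π * Complex.I)‖) (fun n => (hF n).2.aestronglyMeasurable)
      (fun n => ?_) ?_ ?_ ?_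
    · filter_upwards [ae_restrict_mem measurableSet_Ioi] with x hx
      exact hbound n _ (by simpa using le_of_lt hx)
    · filter_upwards with x
      exact hs.mul_right _
    · simp only [tsum_mul_right]
      exact hg.2.norm.const_mul _
    · filter_upwards [ae_restrict_mem measurableSet_Ioi] with x hx
      exact hsum _ (by simpa using le_of_lt hx)
  exact Complex.imCLM.hasSum ((h1.mul_left Complex.I).add h2)

theorem hankelIntegral_eq_of_le {b b' : ℝ} (hb : b ≤ b') {f : ℂ → ℂ} (hf : HankelIntegrable b f)
    (hd : ∀ w : ℂ, 0 ≤ w.im → w.im ≤ π → DifferentiableAt ℂ f w)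
    (hreal : ∀ x : ℝ, (f x).im = 0) :
    hankelIntegral b f = hankelIntegral b' f := by
  have hrect := Complex.integral_boundary_rect_eq_zero_of_differentiableOn f b (b' + π * Complex.I)
    (fun w hw => (hd w (by
      have := hw.2; simp [uIcc_of_le pi_pos.le] at this; exact this.1) (by
      have := hw.2; simp [uIcc_of_le pi_pos.le] at this; exact this.2)).differentiableWithinAt)
  simp only [Complex.ofReal_re, Complex.ofReal_im, Complex.add_re, Complex.add_im, Complex.mul_re,
    Complex.mul_im, Complex.I_re, Complex.I_im, mul_zero, mul_one, zero_mul, sub_zero, add_zero,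
    zero_add, Complex.ofReal_zero, smul_eq_mul] at hrect
  have hbot : (∫ x in b..b', f x).im = 0 := by
    have h1 : ∫ x in b..b', f x = ∫ x in b..b', (((f x).re : ℝ) : ℂ) := by
      refine intervalIntegral.integral_congr fun x _ => ?_
      apply Complex.ext <;> simp [hreal]
    rw [h1, intervalIntegral.integral_ofReal, Complex.ofReal_im]
  have htop : ∫ x in Ioi b, f (x + π * Complex.I) =
      (∫ x in b..b', f (x + π * Complex.I)) + ∫ x in Ioi b', f (x + π * Complex.I) :=
    (intervalIntegral.integral_interval_add_Ioi hf.2 (hf.2.mono_set (Ioi_subset_Ioi hb))).symm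
  have key : Complex.I * (∫ y in (0 : ℝ)..π, f (b + y * Complex.I)) +
      (∫ x in Ioi b, f (x + π * Complex.I)) = (∫ x in b..b', f x) +
      (Complex.I * (∫ y in (0 : ℝ)..π, f (b' + y * Complex.I)) +
      ∫ x in Ioi b', f (x + π * Complex.I)) := by
    rw [htop]
    linear_combination -hrect
  rw [hankelIntegral, hankelIntegral, key, Complex.add_im, hbot, zero_add]

theorem differentiable_hankelKernel (γ : ℝ) : Differentiable ℂ (hankelKernel γ) := by
  unfold hankelKernel
  fun_prop

theorem continuous_hankelKernel (γ : ℝ) : Continuous (hankelKernel γ) :=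
  (differentiable_hankelKernel γ).continuous

theorem hankelKernel_ofReal (γ x : ℝ) : hankelKernel γ x = (rexp (rexp x + γ * x) : ℝ) := by
  simp [hankelKernel]

theorem hankelKernel_add (γ δ : ℝ) (w : ℂ) :
    hankelKernel (γ + δ) w = hankelKernel γ w * Complex.exp (δ * w) := by
  rw [hankelKernel, hankelKernel, ← Complex.exp_add]
  congr 1
  push_cast
  ring

theorem hankelKernel_ray (γ x : ℝ) : hankelKernel γ (x + π * Complex.I) =
    Complex.exp (↑(π * γ) * Complex.I) * (rexp (-rexp x + γ * x) : ℝ) := by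
  rw [hankelKernel, Complex.exp_add_pi_mul_I, Complex.ofReal_exp, ← Complex.exp_add]
  congr 1
  push_cast
  ring

theorem norm_hankelKernel_ray (γ x : ℝ) :
    ‖hankelKernel γ (x + π * Complex.I)‖ = rexp (-rexp x + γ * x) := by
  rw [hankelKernel_ray, norm_mul, Complex.norm_exp_ofReal_mul_I, one_mul, Complex.norm_real,
    Real.norm_of_nonneg (Real.exp_pos _).le]

theorem eventually_neg_exp_add_mul_le (γ : ℝ) : ∀ᶠ x : ℝ in atTop, -rexp x + γ * x ≤ -x := by
  have h := (isLittleO_pow_exp_atTop (n := 1)).def (c := 1 / (|γ| + 1)) (by positivity)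
  filter_upwards [h, eventually_ge_atTop 0] with x hx hx0
  rw [pow_one, Real.norm_of_nonneg hx0, Real.norm_of_nonneg (Real.exp_pos _).le, one_div,
    ← div_eq_inv_mul, le_div_iff₀ (by positivity)] at hx
  nlinarith [le_abs_self γ]

theorem hankelIntegrable_hankelKernel (b γ : ℝ) : HankelIntegrable b (hankelKernel γ) := by
  refine ⟨((continuous_hankelKernel γ).comp (by fun_prop)).intervalIntegrable _ _, ?_⟩
  have hc : Continuous fun x : ℝ => hankelKernel γ (x + π * Complex.I) :=
    (continuous_hankelKernel γ).comp (by fun_prop)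
  rw [IntegrableOn, ← integrable_norm_iff hc.aestronglyMeasurable]
  refine integrable_of_isBigO_exp_neg one_pos hc.norm.continuousOn (IsBigO.of_bound 1 ?_)
  filter_upwards [eventually_neg_exp_add_mul_le γ] with x hx
  rw [norm_norm, norm_hankelKernel_ray, one_mul, Real.norm_of_nonneg (Real.exp_pos _).le]
  exact Real.exp_le_exp.2 (by linarith)

theorem hankelIntegral_hankelKernel_eq (b b' γ : ℝ) :
    hankelIntegral b (hankelKernel γ) = hankelIntegral b' (hankelKernel γ) := by
  have h : ∀ {c c' : ℝ}, c ≤ c' →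
      hankelIntegral c (hankelKernel γ) = hankelIntegral c' (hankelKernel γ) := fun h =>
    hankelIntegral_eq_of_le h (hankelIntegrable_hankelKernel _ γ)
      (fun w _ _ => differentiable_hankelKernel γ w)
      (fun x => by rw [hankelKernel_ofReal, Complex.ofReal_im])
  rcases le_total b b' with hb | hb
  exacts [h hb, (h hb).symm]

theorem hasDerivAt_hankelKernel (γ : ℝ) (w : ℂ) :
    HasDerivAt (hankelKernel γ) (hankelKernel (γ + 1) w + γ * hankelKernel γ w) w := by
  have h : HasDerivAt (hankelKernel γ)
      (Complex.exp (Complex.exp w + γ * w) * (Complex.exp w + γ * 1)) w :=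
    ((Complex.hasDerivAt_exp w).add ((hasDerivAt_id w).const_mul (γ : ℂ))).cexp
  convert h using 1
  rw [hankelKernel_add, hankelKernel]
  push_cast
  ring_nf

theorem hankelIntegral_hankelKernel_add_one (b γ : ℝ) :
    hankelIntegral b (hankelKernel (γ + 1)) = -γ * hankelIntegral b (hankelKernel γ) := by
  have hi1 := hankelIntegrable_hankelKernel b (γ + 1)
  have hi2 := (hankelIntegrable_hankelKernel b γ).const_mul γ
  have hsum := hankelIntegral_add hi1 hi2
  rw [hankelIntegral_const_mul] at hsum
  suffices h : hankelIntegral b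
      (fun w => hankelKernel (γ + 1) w + γ * hankelKernel γ w) = 0 by linarith
  have hv : Complex.I * (∫ y in (0 : ℝ)..π, (hankelKernel (γ + 1) (b + y * Complex.I) +
      γ * hankelKernel γ (b + y * Complex.I))) =
      hankelKernel γ (b + π * Complex.I) - hankelKernel γ b := by
    rw [← intervalIntegral.integral_const_mul, intervalIntegral.integral_eq_sub_of_hasDerivAt
      (f := fun y : ℝ => hankelKernel γ (b + y * Complex.I))]
    · simp
    · intro y _
      have h1 : HasDerivAt (fun y : ℝ => (b : ℂ) + y * Complex.I) Complex.I y := by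
        simpa using ((Complex.ofRealCLM.hasDerivAt (x := y)).mul_const Complex.I).const_add (b : ℂ)
      have := (hasDerivAt_hankelKernel γ (b + y * Complex.I)).comp y h1
      rwa [mul_comm] at this
    · exact (hi1.1.add hi2.1).const_mul _
  have hr : (∫ x in Ioi b, (hankelKernel (γ + 1) (x + π * Complex.I) +
      γ * hankelKernel γ (x + π * Complex.I))) = 0 - hankelKernel γ (b + π * Complex.I) := by
    refine integral_Ioi_of_hasDerivAt_of_tendsto'
      (f := fun x : ℝ => hankelKernel γ (x + π * Complex.I)) (fun x _ => ?_) (hi1.2.add hi2.2) ?_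
    · have h1 : HasDerivAt (fun x : ℝ => (x : ℂ) + π * Complex.I) 1 x := by
        simpa using (Complex.ofRealCLM.hasDerivAt (x := x)).add_const (π * Complex.I : ℂ)
      have := (hasDerivAt_hankelKernel γ (x + π * Complex.I)).comp x h1
      rwa [mul_one] at this
    · rw [tendsto_zero_iff_norm_tendsto_zero]
      refine squeeze_zero' (Eventually.of_forall fun _ => norm_nonneg _) ?_
        tendsto_exp_neg_atTop_nhds_zero
      filter_upwards [eventually_neg_exp_add_mul_le γ] with x hx
      rw [norm_hankelKernel_ray]
      exact Real.exp_le_exp.2 hx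
  rw [hankelIntegral, hv, hr, hankelKernel_ofReal, Complex.add_im, Complex.sub_im, Complex.sub_im,
    Complex.ofReal_im, Complex.zero_im]
  ring

theorem integral_hankelKernel_ray (b γ : ℝ) :
    ∫ x in Ioi b, hankelKernel γ (x + π * Complex.I) =
      Complex.exp (↑(π * γ) * Complex.I) *
        ((∫ y in Ioi (rexp b), rexp (-y) * y ^ (γ - 1) : ℝ) : ℂ) := by
  simp only [hankelKernel_ray]
  rw [integral_const_mul, ← integral_comp_exp_Ioi (fun y => rexp (-y) * y ^ (γ - 1)),
    ← integral_complex_ofReal]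
  congr 1
  refine integral_congr_ae (Eventually.of_forall fun x => ?_)
  simp only [smul_eq_mul]
  rw [← Real.exp_mul, ← Real.exp_add, ← Real.exp_add]
  congr 2
  ring

theorem hankelIntegral_hankelKernel_of_pos (b : ℝ) {γ : ℝ} (hγ : 0 < γ) :
    hankelIntegral b (hankelKernel γ) = π * (Real.Gamma (1 - γ))⁻¹ := by
  have hvert : Tendsto (fun c : ℝ =>
      Complex.I * ∫ y in (0 : ℝ)..π, hankelKernel γ (c + y * Complex.I)) atBot (nhds 0) := by
    rw [tendsto_zero_iff_norm_tendsto_zero]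
    have hlim : Tendsto (fun c : ℝ => rexp (rexp c) * rexp (γ * c) * π) atBot (nhds 0) := by
      have h1 : Tendsto (fun c : ℝ => rexp (rexp c)) atBot (nhds 1) := by
        simpa [Function.comp_def] using (Real.continuous_exp.tendsto 0).comp Real.tendsto_exp_atBot
      have h2 : Tendsto (fun c : ℝ => rexp (γ * c)) atBot (nhds 0) :=
        Real.tendsto_exp_atBot.comp (tendsto_id.const_mul_atBot hγ)
      simpa using (h1.mul h2).mul_const π
    refine squeeze_zero (fun _ => norm_nonneg _) (fun c => ?_) hlim
    rw [norm_mul, Complex.norm_I, one_mul]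
    refine (intervalIntegral.norm_integral_le_of_norm_le_const (fun y _ => ?_)).trans_eq
      (by rw [sub_zero, abs_of_pos pi_pos])
    rw [hankelKernel, Complex.norm_exp, ← Real.exp_add, Real.exp_le_exp, Complex.add_re]
    refine add_le_add ((Complex.re_le_norm _).trans_eq ?_) (by simp)
    simp [Complex.norm_exp]
  have hray : Tendsto (fun c : ℝ => ∫ x in Ioi c, hankelKernel γ (x + π * Complex.I)) atBot
      (nhds (Complex.exp (↑(π * γ) * Complex.I) * (Real.Gamma γ : ℂ))) := by
    simp only [integral_hankelKernel_ray]
    refine Tendsto.const_mul _ ((Complex.continuous_ofReal.tendsto _).comp ?_)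
    have hcover := aecover_Ioi_of_Ioi (μ := volume) (A := (0 : ℝ)) Real.tendsto_exp_atBot
    have := hcover.integral_tendsto_of_countably_generated (Real.GammaIntegral_convergent hγ)
    rw [Real.Gamma_eq_integral hγ]
    refine this.congr fun c => ?_
    rw [Measure.restrict_restrict measurableSet_Ioi,
      inter_eq_left.2 (Ioi_subset_Ioi (Real.exp_pos c).le)]
  have hlim := (Complex.continuous_im.tendsto _).comp (hvert.add hray)
  have hconst : Tendsto (fun _ : ℝ => hankelIntegral b (hankelKernel γ)) atBot
      (nhds (sin (π * γ) * Real.Gamma γ)) := by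
    refine (hlim.congr fun c => hankelIntegral_hankelKernel_eq c b γ).trans_eq ?_
    rw [zero_add, Complex.im_mul_ofReal, Complex.exp_ofReal_mul_I_im]
  rw [tendsto_nhds_unique tendsto_const_nhds hconst]
  have href := Real.Gamma_mul_Gamma_one_sub γ
  by_cases hs : sin (π * γ) = 0
  · rw [hs, div_zero, mul_eq_zero] at href
    rw [hs, href.resolve_left (Real.Gamma_pos_of_pos hγ).ne', inv_zero, zero_mul, mul_zero]
  · have h1 : Real.Gamma (1 - γ) ≠ 0 := fun h => by
      rw [h, mul_zero] at href
      exact (div_ne_zero pi_ne_zero hs) href.symm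
    rw [eq_div_iff hs] at href
    rw [← div_eq_mul_inv, eq_div_iff h1]
    linarith

theorem Real.one_div_Gamma_eq_self_mul_one_div_Gamma_add_one (s : ℝ) :
    (Real.Gamma s)⁻¹ = s * (Real.Gamma (s + 1))⁻¹ := by
  have h := Complex.one_div_Gamma_eq_self_mul_one_div_Gamma_add_one s
  rw [← Complex.ofReal_one, ← Complex.ofReal_add, Complex.Gamma_ofReal, Complex.Gamma_ofReal] at h
  exact_mod_cast h

theorem norm_hankelKernel_le_add {γ : ℝ} (hγ : γ ∈ Icc (0 : ℝ) 1) (w : ℂ) :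
    ‖hankelKernel γ w‖ ≤ ‖hankelKernel 0 w‖ + ‖hankelKernel 1 w‖ := by
  have h1 : hankelKernel γ w = hankelKernel 0 w * Complex.exp (γ * w) := by
    rw [← hankelKernel_add, zero_add]
  have h2 : hankelKernel 1 w = hankelKernel 0 w * Complex.exp w := by
    simpa using hankelKernel_add 0 1 w
  rw [h1, h2, norm_mul, norm_mul, ← mul_one_add, Complex.norm_exp, Complex.norm_exp,
    Complex.re_ofReal_mul]
  gcongr
  rcases le_total w.re 0 with h | h
  · have : rexp (γ * w.re) ≤ 1 := Real.exp_le_one_iff.2 (mul_nonpos_of_nonneg_of_nonpos hγ.1 h)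
    linarith [Real.exp_pos w.re]
  · have : rexp (γ * w.re) ≤ rexp w.re := Real.exp_le_exp.2 (by nlinarith [hγ.2])
    linarith

theorem tendsto_hankelIntegral_hankelKernel_zero (b : ℝ) :
    Tendsto (fun γ => hankelIntegral b (hankelKernel γ)) (nhdsWithin 0 (Ioi 0))
      (nhds (hankelIntegral b (hankelKernel 0))) := by
  have hcont : ∀ w : ℂ, Tendsto (fun γ : ℝ => hankelKernel γ w) (nhdsWithin 0 (Ioi 0))
      (nhds (hankelKernel 0 w)) := fun w => by
    have : Continuous fun γ : ℝ => hankelKernel γ w := by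
      unfold hankelKernel
      fun_prop
    exact this.continuousWithinAt
  have hmem : ∀ᶠ γ : ℝ in nhdsWithin 0 (Ioi 0), γ ∈ Icc (0 : ℝ) 1 := by
    filter_upwards [Ioo_mem_nhdsGT one_pos] with γ hγ using Ioo_subset_Icc_self hγ
  have hi0 := hankelIntegrable_hankelKernel b 0
  have hi1 := hankelIntegrable_hankelKernel b 1
  refine (Complex.continuous_im.tendsto _).comp (Tendsto.add (Tendsto.const_mul _ ?_) ?_)
  · refine intervalIntegral.tendsto_integral_filter_of_dominated_convergence _
      (Eventually.of_forall fun γ => ?_) ?_ (hi0.1.norm.add hi1.1.norm) ?_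
    · have := (hankelIntegrable_hankelKernel b γ).1.aestronglyMeasurable
      rwa [uIoc_of_le pi_pos.le]
    · filter_upwards [hmem] with γ hγ
      exact Eventually.of_forall fun y _ => norm_hankelKernel_le_add hγ _
    · exact Eventually.of_forall fun y _ => hcont _
  · refine MeasureTheory.tendsto_integral_filter_of_dominated_convergence _
      (Eventually.of_forall fun γ => (hankelIntegrable_hankelKernel b γ).2.aestronglyMeasurable) ?_
      (hi0.2.norm.add hi1.2.norm) (Eventually.of_forall fun x => hcont _)
    filter_upwards [hmem] with γ hγ
    exact Eventually.of_forall fun x => norm_hankelKernel_le_add hγ _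

/-- Hankel's formula for the reciprocal of the Gamma function. -/
theorem hankelIntegral_hankelKernel (b γ : ℝ) :
    hankelIntegral b (hankelKernel γ) = π * (Real.Gamma (1 - γ))⁻¹ := by
  have hmain : ∀ (n : ℕ) (γ : ℝ), -n < γ →
      hankelIntegral b (hankelKernel γ) = π * (Real.Gamma (1 - γ))⁻¹ := by
    intro n
    induction n with
    | zero => exact fun γ hγ => hankelIntegral_hankelKernel_of_pos b (by simpa using hγ)
    | succ n ih =>
      intro γ hγ
      rcases eq_or_ne γ 0 with rfl | h0
      · refine tendsto_nhds_unique (tendsto_hankelIntegral_hankelKernel_zero b) ?_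
        have hG : ContinuousAt (fun γ : ℝ => π * (Real.Gamma (1 - γ))⁻¹) 0 := by
          refine continuousAt_const.mul (ContinuousAt.inv₀ ?_ (by simp))
          refine ContinuousAt.comp (g := Real.Gamma)
            (Real.differentiableAt_Gamma fun m => ?_).continuousAt (by fun_prop)
          have : (0 : ℝ) ≤ m := m.cast_nonneg
          intro h
          linarith
        refine (hG.continuousWithinAt (s := Ioi 0)).congr' ?_
        filter_upwards [self_mem_nhdsWithin] with δ hδ
        exact (hankelIntegral_hankelKernel_of_pos b hδ).symm
      · have h1 := ih (γ + 1) (by push_cast at hγ; linarith)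
        rw [hankelIntegral_hankelKernel_add_one, Real.one_div_Gamma_eq_self_mul_one_div_Gamma_add_one,
          show 1 - (γ + 1) = -γ by ring, show -γ + 1 = 1 - γ by ring] at h1
        refine mul_left_cancel₀ (neg_ne_zero.2 h0) ?_
        rw [h1]
        ring
  obtain ⟨n, hn⟩ := exists_nat_gt (-γ)
  exact hmain n γ (by linarith)

theorem mul_sin_le_norm_exp_add {α t : ℝ} (hα0 : 0 < α) (hα1 : α < 1) (ht : 0 < t) {w : ℂ}
    (hw0 : 0 ≤ w.im) (hw1 : w.im ≤ π) : t * sin (π * α) ≤ ‖Complex.exp (α * w) + t‖ := by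
  set r := rexp (α * w.re) with hr
  have hr0 : 0 < r := Real.exp_pos _
  have hcos : cos (π * α) ≤ cos (α * w.im) :=
    Real.cos_le_cos_of_nonneg_of_le_pi (by positivity) (by nlinarith [pi_pos])
      (by nlinarith [pi_pos])
  have hnorm : ‖Complex.exp (α * w) + t‖ ^ 2 = r ^ 2 + 2 * r * t * cos (α * w.im) + t ^ 2 := by
    rw [Complex.sq_norm, Complex.normSq_apply]
    simp only [Complex.add_re, Complex.add_im, Complex.exp_re, Complex.exp_im,
      Complex.re_ofReal_mul, Complex.im_ofReal_mul, Complex.ofReal_re, Complex.ofReal_im, ← hr]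
    linear_combination r ^ 2 * Real.sin_sq_add_cos_sq (α * w.im)
  refine le_of_sq_le_sq ?_ (norm_nonneg _)
  rw [hnorm]
  nlinarith [Real.sin_sq_add_cos_sq (π * α), sq_nonneg (r + t * cos (π * α)),
    mul_le_mul_of_nonneg_left hcos (by positivity : 0 ≤ 2 * r * t)]

theorem norm_hankelKernel_div_le {α γ t : ℝ} (hα0 : 0 < α) (hα1 : α < 1) (ht : 0 < t) {w : ℂ}
    (hw0 : 0 ≤ w.im) (hw1 : w.im ≤ π) : ‖hankelKernel γ w / (Complex.exp (α * w) + t)‖ ≤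
      (t * sin (π * α))⁻¹ * ‖hankelKernel γ w‖ := by
  have hs : 0 < sin (π * α) :=
    Real.sin_pos_of_pos_of_lt_pi (by positivity) (by nlinarith [pi_pos])
  rw [norm_div, div_eq_inv_mul]
  gcongr
  exact mul_sin_le_norm_exp_add hα0 hα1 ht hw0 hw1

theorem differentiableAt_hankelKernel_div {α γ t : ℝ} (hα0 : 0 < α) (hα1 : α < 1) (ht : 0 < t)
    {w : ℂ} (hw0 : 0 ≤ w.im) (hw1 : w.im ≤ π) :
    DifferentiableAt ℂ (fun w => hankelKernel γ w / (Complex.exp (α * w) + t)) w := by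
  have hs : 0 < sin (π * α) :=
    Real.sin_pos_of_pos_of_lt_pi (by positivity) (by nlinarith [pi_pos])
  refine (differentiable_hankelKernel γ w).div (by fun_prop) (norm_pos_iff.1 ?_)
  exact (mul_pos ht hs).trans_le (mul_sin_le_norm_exp_add hα0 hα1 ht hw0 hw1)

theorem hankelIntegrable_hankelKernel_div {α t : ℝ} (hα0 : 0 < α) (hα1 : α < 1) (ht : 0 < t)
    (b γ : ℝ) :
    HankelIntegrable b (fun w => hankelKernel γ w / (Complex.exp (α * w) + t)) := by
  have hker := hankelIntegrable_hankelKernel b γ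
  constructor
  · refine ContinuousOn.intervalIntegrable fun y hy => ?_
    rw [uIcc_of_le pi_pos.le] at hy
    have h := (differentiableAt_hankelKernel_div (γ := γ) (w := b + y * Complex.I) hα0 hα1 ht
      (by simpa using hy.1) (by simpa using hy.2)).continuousAt
    exact (ContinuousAt.comp (f := fun y : ℝ => (b : ℂ) + y * Complex.I) h
      (by fun_prop)).continuousWithinAt
  · have hcont : Continuous fun x : ℝ => hankelKernel γ (x + π * Complex.I) /
        (Complex.exp (α * (x + π * Complex.I)) + t) := continuous_iff_continuousAt.2 fun x =>
      ContinuousAt.comp (f := fun x : ℝ => (x : ℂ) + π * Complex.I)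
        (differentiableAt_hankelKernel_div (γ := γ) (w := x + π * Complex.I) hα0 hα1 ht
          (by simpa using pi_pos.le) (by simp)).continuousAt (by fun_prop)
    refine (hker.2.norm.const_mul (t * sin (π * α))⁻¹).mono' hcont.aestronglyMeasurable ?_
    exact Eventually.of_forall fun x =>
      norm_hankelKernel_div_le hα0 hα1 ht (by simpa using pi_pos.le) (by simp)

theorem mittagLeffler_neg_eq_hankelIntegral {α t : ℝ} (hα0 : 0 < α) (hα1 : α < 1) (ht : 0 < t)
    (b : ℝ) : π * mittagLeffler α 1 (-t) =
      hankelIntegral b (fun w => hankelKernel α w / (Complex.exp (α * w) + t)) := by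
  have hi := hankelIntegrable_hankelKernel_div hα0 hα1 ht
  set b' := max b ((Real.log t + 1) / α) with hb'
  have hlog : Real.log t < α * b' := by
    have : (Real.log t + 1) / α ≤ b' := le_max_right _ _
    rw [div_le_iff₀ hα0] at this
    linarith
  rw [hankelIntegral_eq_of_le (le_max_left b ((Real.log t + 1) / α)) (hi b α)
    (fun w h0 h1 => differentiableAt_hankelKernel_div hα0 hα1 ht h0 h1) (fun x => by
      rw [hankelKernel_ofReal, ← Complex.ofReal_mul, ← Complex.ofReal_exp, ← Complex.ofReal_add,
        ← Complex.ofReal_div, Complex.ofReal_im]), ← hb']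
  set q := t * rexp (-(α * b')) with hq
  have hq1 : q < 1 := by
    rw [hq, Real.exp_neg, ← div_eq_mul_inv, div_lt_one (Real.exp_pos _)]
    exact (Real.log_lt_iff_lt_exp ht).1 hlog
  have hratio : ∀ w : ℂ, b' ≤ w.re → ‖-t * Complex.exp (-(α * w))‖ ≤ q := fun w hw => by
    rw [norm_mul, norm_neg, Complex.norm_real, Real.norm_of_nonneg ht.le, Complex.norm_exp, hq,
      Complex.neg_re, Complex.re_ofReal_mul]
    gcongr
  have hterm : ∀ (n : ℕ) (w : ℂ), ((-t) ^ n : ℝ) * hankelKernel (-(α * n)) w =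
      hankelKernel 0 w * (-t * Complex.exp (-(α * w))) ^ n := fun n w => by
    rw [← zero_add (-(α * n)), hankelKernel_add, mul_pow, ← Complex.exp_nat_mul]
    push_cast
    ring_nf
  have hsum := hasSum_hankelIntegral (b := b') (q := q) (g := hankelKernel 0)
    (F := fun n w => ((-t) ^ n : ℝ) * hankelKernel (-(α * n)) w)
    (f := fun w => hankelKernel α w / (Complex.exp (α * w) + t))
    (hankelIntegrable_hankelKernel b' 0) (by positivity) hq1
    (fun n => (hankelIntegrable_hankelKernel b' _).const_mul _)
    (fun n w hw => by
      rw [hterm, norm_mul, norm_pow, mul_comm]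
      gcongr
      exact hratio w hw)
    (fun w hw => by
      simp only [hterm]
      have hlt := (hratio w hw).trans_lt hq1
      have heq : hankelKernel α w / (Complex.exp (α * w) + t) =
          hankelKernel 0 w * (1 - -t * Complex.exp (-(α * w)))⁻¹ := by
        have hker := hankelKernel_add 0 α w
        rw [zero_add] at hker
        rw [hker, mul_div_assoc, Complex.exp_neg]
        congr 1
        field_simp
        ring
      rw [heq]
      exact (hasSum_geometric_of_norm_lt_one hlt).mul_left _)
  simp only [hankelIntegral_const_mul, hankelIntegral_hankelKernel] at hsum
  rw [← hsum.tsum_eq, mittagLeffler, ← tsum_mul_left]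
  refine tsum_congr fun n => ?_
  rw [sub_neg_eq_add, add_comm (1 : ℝ)]
  ring

theorem mittagLeffler_neg_sub_eq {α t : ℝ} (hα0 : 0 < α) (hα1 : α < 1) (ht : 0 < t) (b : ℝ) :
    mittagLeffler α 1 (-t) - 1 / (t * Real.Gamma (1 - α)) = -(π * t)⁻¹ *
      hankelIntegral b (fun w => hankelKernel (α + α) w / (Complex.exp (α * w) + t)) := by
  have hs : 0 < sin (π * α) :=
    Real.sin_pos_of_pos_of_lt_pi (by positivity) (by nlinarith [pi_pos])
  have h := hankelIntegral_add
    ((hankelIntegrable_hankelKernel_div hα0 hα1 ht b α).const_mul (t : ℝ))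
    (hankelIntegrable_hankelKernel_div hα0 hα1 ht b (α + α))
  have heq : hankelIntegral b (hankelKernel α) = hankelIntegral b (fun w =>
      (t : ℝ) * (hankelKernel α w / (Complex.exp (α * w) + t)) +
        hankelKernel (α + α) w / (Complex.exp (α * w) + t)) :=
    hankelIntegral_congr fun w h0 h1 => by
      have hne : Complex.exp (α * w) + t ≠ 0 :=
        norm_pos_iff.1 ((mul_pos ht hs).trans_le (mul_sin_le_norm_exp_add hα0 hα1 ht h0 h1))
      rw [hankelKernel_add]
      field_simp
      ring
  rw [← heq, hankelIntegral_const_mul, hankelIntegral_hankelKernel,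
    ← mittagLeffler_neg_eq_hankelIntegral hα0 hα1 ht b] at h
  have hG : Real.Gamma (1 - α) ≠ 0 := (Real.Gamma_pos_of_pos (by linarith)).ne'
  rw [eq_sub_of_add_eq' h.symm]
  field_simp
  ring

theorem mittagLeffler_asymptotic (α : ℝ) (hα0 : 0 < α) (hα1 : α < 1) :
    (fun t : ℝ => mittagLeffler α 1 (-t) - 1 / (t * Real.Gamma (1 - α)))
      =O[atTop] (fun t : ℝ => 1 / t ^ 2) ∧
    Tendsto (fun t : ℝ => t * mittagLeffler α 1 (-t)) atTop
      (nhds (1 / Real.Gamma (1 - α))) := by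
  have hO : (fun t : ℝ => mittagLeffler α 1 (-t) - 1 / (t * Real.Gamma (1 - α)))
      =O[atTop] (fun t : ℝ => 1 / t ^ 2) := by
    have hi := hankelIntegrable_hankelKernel 0 (α + α)
    refine IsBigO.of_bound (π⁻¹ * ((sin (π * α))⁻¹ *
      ((∫ y in (0 : ℝ)..π, ‖hankelKernel (α + α) ((0 : ℝ) + y * Complex.I)‖) +
        ∫ x in Ioi (0 : ℝ), ‖hankelKernel (α + α) (x + π * Complex.I)‖))) ?_
    filter_upwards [eventually_gt_atTop 0] with t ht
    have h := abs_hankelIntegral_le hi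
      (f := fun w => hankelKernel (α + α) w / (Complex.exp (α * w) + t))
      (fun w h0 h1 => norm_hankelKernel_div_le hα0 hα1 ht h0 h1)
    rw [mittagLeffler_neg_sub_eq hα0 hα1 ht 0, norm_mul, Real.norm_eq_abs, Real.norm_eq_abs,
      abs_neg, abs_of_pos (by positivity : 0 < (π * t)⁻¹),
      Real.norm_of_nonneg (by positivity : 0 ≤ 1 / t ^ 2)]
    refine (mul_le_mul_of_nonneg_left h (by positivity)).trans_eq ?_
    rw [mul_inv, mul_inv]
    ring
  refine ⟨hO, ?_⟩
  have h1 : Tendsto (fun t : ℝ => t * (mittagLeffler α 1 (-t) - 1 / (t * Real.Gamma (1 - α))))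
      atTop (nhds 0) := by
    refine ((isBigO_refl (fun t : ℝ => t) atTop).mul hO).trans_tendsto ?_
    refine tendsto_inv_atTop_zero.congr' ?_
    filter_upwards [eventually_gt_atTop 0] with t ht
    field_simp
  have h2 := h1.add_const (1 / Real.Gamma (1 - α))
  rw [zero_add] at h2
  refine h2.congr' ?_
  filter_upwards [eventually_gt_atTop 0] with t ht
  have hG : Real.Gamma (1 - α) ≠ 0 := (Real.Gamma_pos_of_pos (by linarith)).ne'
  field_simp
  ring
end

section
/- Let 1 < β < 2 and η ≥ (3/2)β. Then E_{β,η}(-t) > 0 for all t ≥ 0 (the function has no real zeros on the negative real axis). -/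
open Real

/-- A power series converging everywhere is continuous along `u ↦ t * u ^ 2` on `[0, 1]`. -/
theorem continuousOn_tsum_mul_sq {a : ℕ → ℝ} (ha : ∀ t : ℝ, Summable fun n => a n * t ^ n)
    (t : ℝ) : ContinuousOn (fun u : ℝ => ∑' n, a n * (t * u ^ 2) ^ n) (Set.Icc 0 1) := by
  refine continuousOn_tsum (u := fun n => ‖a n * t ^ n‖) (fun n => by fun_prop) (ha t).norm ?_
  intro n u hu
  rw [mul_pow, ← mul_assoc, norm_mul _ ((u ^ 2) ^ n)]
  refine mul_le_of_le_one_right (norm_nonneg _) ?_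
  rw [norm_of_nonneg (by positivity)]
  exact pow_le_one₀ (by positivity) (pow_le_one₀ hu.1 hu.2)

theorem hasSum_integral_pow_mul_tsum {a : ℕ → ℝ}
    (ha : ∀ t : ℝ, Summable fun n => a n * t ^ n) (p : ℕ) (t : ℝ) :
    HasSum (fun n : ℕ => a n * t ^ n / (2 * n + p + 1))
      (∫ u in (0 : ℝ)..1, u ^ p * ∑' n, a n * (t * u ^ 2) ^ n) := by
  have key := intervalIntegral.hasSum_intervalIntegral_of_summable_norm (a := (0 : ℝ)) (b := 1)
    (f := fun n : ℕ =>
      (⟨fun u : ℝ => u ^ p * (a n * (t * u ^ 2) ^ n), by fun_prop⟩ : C(ℝ, ℝ))) ?_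
  · simp only [ContinuousMap.coe_mk, tsum_mul_left] at key
    convert! key using 1
    funext n
    have : ∀ u : ℝ, u ^ p * (a n * (t * u ^ 2) ^ n) = a n * t ^ n * u ^ (2 * n + p) := by
      intro u; ring
    simp only [this, intervalIntegral.integral_const_mul, integral_pow]
    push_cast
    simp [div_eq_mul_inv]
  · refine Summable.of_nonneg_of_le (fun _ => norm_nonneg _) (fun n => ?_) (ha t).norm
    rw [ContinuousMap.norm_le _ (norm_nonneg _)]
    rintro ⟨u, hu⟩
    have hu' : u ∈ Set.Icc (0 : ℝ) 1 := by simpa [Set.uIcc_of_le] using hu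
    have : u ^ p * (a n * (t * u ^ 2) ^ n) = a n * t ^ n * u ^ (2 * n + p) := by ring
    simp only [ContinuousMap.restrict_apply, ContinuousMap.coe_mk, this]
    rw [norm_mul _ (u ^ _)]
    refine mul_le_of_le_one_right (norm_nonneg _) ?_
    rw [norm_of_nonneg (pow_nonneg hu'.1 _)]
    exact pow_le_one₀ hu'.1 hu'.2

theorem integral_pow_mul_tsum_nonneg {a : ℕ → ℝ}
    (hpos : ∀ t : ℝ, 0 ≤ t → 0 ≤ ∑' n, a n * t ^ n) (p : ℕ) {t : ℝ} (ht : 0 ≤ t) :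
    0 ≤ ∫ u in (0 : ℝ)..1, u ^ p * ∑' n, a n * (t * u ^ 2) ^ n := by
  refine intervalIntegral.integral_nonneg zero_le_one fun u hu => ?_
  exact mul_nonneg (pow_nonneg hu.1 _) (hpos _ (by positivity))

open Filter Topology in
theorem integral_pow_mul_tsum_pos {a : ℕ → ℝ} (ha : ∀ t : ℝ, Summable fun n => a n * t ^ n)
    (hpos : ∀ t : ℝ, 0 ≤ t → 0 ≤ ∑' n, a n * t ^ n) (ha0 : 0 < a 0) (p : ℕ) {t : ℝ}
    (ht : 0 ≤ t) :
    0 < ∫ u in (0 : ℝ)..1, u ^ p * ∑' n, a n * (t * u ^ 2) ^ n := by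
  have hc := continuousOn_tsum_mul_sq ha t
  refine intervalIntegral.integral_pos zero_lt_one (by fun_prop)
    (fun u hu => mul_nonneg (pow_nonneg hu.1.le _) (hpos _ (by positivity))) ?_
  have h0 : (∑' n, a n * (t * (0 : ℝ) ^ 2) ^ n) = a 0 := by
    rw [tsum_eq_single 0 (fun n hn => by simp [hn])]
    simp
  have h1 := (hc 0 (by simp)).tendsto
  simp only [h0] at h1
  have h2 : ∀ᶠ u in 𝓝[Set.Ioc 0 1] (0 : ℝ), 0 < ∑' n, a n * (t * u ^ 2) ^ n :=
    (h1.mono_left (nhdsWithin_mono _ Set.Ioc_subset_Icc_self)).eventually (lt_mem_nhds ha0)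
  have : (𝓝[Set.Ioc 0 1] (0 : ℝ)).NeBot := by
    rw [nhdsWithin_Ioc_eq_nhdsGT zero_lt_one]; infer_instance
  obtain ⟨c, hc0, hc1⟩ := (h2.and self_mem_nhdsWithin).exists
  exact ⟨c, Set.Ioc_subset_Icc_self hc1, mul_pos (pow_pos hc1.1 _) hc0⟩

/-- Multiplying the coefficients by `c + b / (2 n + p + 1)` acts on the sum of a power series as
`f ↦ c f(t) + b ∫₀¹ uᵖ f(t u²) du`. -/
theorem hasSum_add_div_mul {a : ℕ → ℝ} (ha : ∀ t : ℝ, Summable fun n => a n * t ^ n)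
    (c b : ℝ) (p : ℕ) (t : ℝ) :
    HasSum (fun n : ℕ => (c + b / (2 * n + p + 1)) * a n * t ^ n)
      (c * ∑' n, a n * t ^ n + b * ∫ u in (0 : ℝ)..1, u ^ p * ∑' n, a n * (t * u ^ 2) ^ n) := by
  convert! ((ha t).hasSum.mul_left c).add ((hasSum_integral_pow_mul_tsum ha p t).mul_left b)
    using 2 with n
  ring

theorem summable_alternating_pow_div_factorial (t : ℝ) :
    Summable fun n : ℕ => (-1) ^ n / ((2 * n + 2).factorial : ℝ) * t ^ n := by
  refine Summable.of_norm_bounded (Real.summable_pow_div_factorial |t|) fun n => ?_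
  rw [norm_mul, norm_div, norm_pow, norm_pow]
  simp only [norm_neg, norm_one, one_pow, Real.norm_eq_abs]
  rw [div_mul_eq_mul_div, one_mul, Nat.abs_cast]
  gcongr
  omega

theorem tsum_alternating_pow_div_factorial_nonneg {t : ℝ} (ht : 0 ≤ t) :
    0 ≤ ∑' n : ℕ, (-1) ^ n / ((2 * n + 2).factorial : ℝ) * t ^ n := by
  rcases ht.eq_or_lt with rfl | ht'
  · rw [tsum_eq_single 0 (fun n hn => by simp [hn])]
    positivity
  have h := (hasSum_nat_add_iff' 1).2 (Real.hasSum_cos √t)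
  have h2 : ∑' n : ℕ, (-1) ^ n / ((2 * n + 2).factorial : ℝ) * t ^ n
      = (1 - Real.cos √t) / t := by
    refine HasSum.tsum_eq ?_
    convert! h.div_const (-t) using 1
    · funext n
      rw [pow_mul √t, Real.sq_sqrt ht, show 2 * (n + 1) = 2 * n + 2 by ring]
      field_simp
      ring
    · simp only [Finset.range_one, Finset.sum_singleton, pow_zero, mul_zero, Nat.factorial_zero,
        Nat.cast_one, mul_one, div_one]
      rw [div_neg, ← neg_div, neg_sub]
  rw [h2]
  exact div_nonneg (by linarith [Real.cos_le_one √t]) ht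

theorem summable_and_tsum_prod_nonneg {β η : ℝ} (hβ0 : 0 ≤ β) (hβ2 : β ≤ 2)
    (hη : (3 / 2) * β ≤ η) (S : Finset ℕ) :
    (∀ t : ℝ, Summable fun n : ℕ => (∏ j ∈ S, (β * n + η + j) / (2 * n + 3 + j)) *
      ((-1) ^ n / ((2 * n + 2).factorial : ℝ)) * t ^ n) ∧
    ∀ t : ℝ, 0 ≤ t → 0 ≤ ∑' n : ℕ, (∏ j ∈ S, (β * n + η + j) / (2 * n + 3 + j)) *
      ((-1) ^ n / ((2 * n + 2).factorial : ℝ)) * t ^ n := by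
  induction S using Finset.induction_on with
  | empty =>
    simp only [Finset.prod_empty, one_mul]
    exact ⟨summable_alternating_pow_div_factorial,
      fun t => tsum_alternating_pow_div_factorial_nonneg⟩
  | insert k S hk ih =>
    obtain ⟨ih1, ih2⟩ := ih
    have hb : 0 ≤ k + η - β / 2 * (k + 3) := by
      have : (0 : ℝ) ≤ k := k.cast_nonneg
      nlinarith
    have key := hasSum_add_div_mul ih1 (β / 2) (k + η - β / 2 * (k + 3)) (k + 2)
    have heq : ∀ t : ℝ, (fun n : ℕ => (∏ j ∈ insert k S, (β * n + η + j) / (2 * n + 3 + j)) *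
        ((-1) ^ n / ((2 * n + 2).factorial : ℝ)) * t ^ n) = fun n : ℕ =>
        (β / 2 + (k + η - β / 2 * (k + 3)) / (2 * n + (k + 2 : ℕ) + 1)) *
        ((∏ j ∈ S, (β * n + η + j) / (2 * n + 3 + j)) *
          ((-1) ^ n / ((2 * n + 2).factorial : ℝ))) * t ^ n := by
      intro t
      funext n
      rw [Finset.prod_insert hk, mul_assoc (_ / _ : ℝ)]
      congr 2
      have : (2 * n + 3 + k : ℝ) ≠ 0 := by positivity
      have h' : (2 * n + (k + 2 : ℕ) + 1 : ℝ) = 2 * n + 3 + k := by push_cast; ring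
      rw [h']
      field_simp
      ring
    refine ⟨fun t => heq t ▸ (key t).summable, fun t ht => ?_⟩
    rw [heq t, (key t).tsum_eq]
    exact add_nonneg (mul_nonneg (by positivity) (ih2 t ht))
      (mul_nonneg hb (integral_pow_mul_tsum_nonneg ih2 _ ht))

theorem GammaSeq_pos {s : ℝ} (hs : 0 < s) {n : ℕ} (hn : n ≠ 0) : 0 < GammaSeq s n := by
  have : (0 : ℝ) < n := by positivity
  have : 0 < ∏ j ∈ Finset.range (n + 1), (s + j) := Finset.prod_pos fun j _ => by positivity
  unfold GammaSeq
  positivity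

theorem GammaSeq_succ {s : ℝ} (hs : 0 < s) {n : ℕ} (hn : n ≠ 0) :
    GammaSeq s (n + 1) =
      GammaSeq s n * ((1 + (n : ℝ)⁻¹) ^ s * (n + 1) / (s + (n + 1 : ℕ))) := by
  have h0 : (0 : ℝ) < n := by positivity
  have h1 : ((n + 1 : ℕ) : ℝ) = n * (1 + (n : ℝ)⁻¹) := by push_cast; field_simp
  have h2 : 0 < ∏ j ∈ Finset.range (n + 1), (s + j) := Finset.prod_pos fun j _ => by positivity
  have h3 : 0 < s + (n + 1 : ℕ) := by positivity
  have h4 : ((n + 1 : ℕ) : ℝ) ^ s = (n : ℝ) ^ s * (1 + (n : ℝ)⁻¹) ^ s := by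
    rw [h1, mul_rpow h0.le (by positivity)]
  unfold GammaSeq
  rw [Finset.prod_range_succ _ (n + 1), Nat.factorial_succ, h4]
  push_cast at h3 ⊢
  field_simp

/-- Euler's approximations of a ratio of Gamma values increase to their limit. -/
theorem GammaSeq_div_GammaSeq_le {s a : ℝ} (hs : 0 < s) (ha : 1 ≤ a) {n : ℕ} (hn : n ≠ 0) :
    GammaSeq (s + a) n / GammaSeq s n ≤ Gamma (s + a) / Gamma s := by
  have hsa : 0 < s + a := by linarith
  have hmono : Monotone fun m : ℕ => GammaSeq (s + a) (m + 1) / GammaSeq s (m + 1) := by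
    refine monotone_nat_of_le_succ fun m => ?_
    have hm : m + 1 ≠ 0 := by omega
    rw [GammaSeq_succ hs hm, GammaSeq_succ hsa hm]
    have g1 := GammaSeq_pos hs hm
    have g2 := GammaSeq_pos hsa hm
    generalize hx : ((m + 1 : ℕ) : ℝ) = x
    have hx0 : 0 < x := by rw [← hx]; positivity
    have hx' : ((m + 1 + 1 : ℕ) : ℝ) = x + 1 := by rw [← hx]; push_cast; ring
    rw [hx', mul_div_mul_comm]
    refine le_mul_of_one_le_right (by positivity) ?_
    have hB := one_add_mul_self_le_rpow_one_add (s := x⁻¹)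
      (by linarith [inv_pos.2 hx0]) ha
    rw [rpow_add (by positivity)]
    have hp : 0 < (1 + x⁻¹) ^ s := by positivity
    have : (1 + x⁻¹) ^ s * (1 + x⁻¹) ^ a * (x + 1) / (s + a + (x + 1)) /
        ((1 + x⁻¹) ^ s * (x + 1) / (s + (x + 1))) =
        (1 + x⁻¹) ^ a * (s + (x + 1)) / (s + a + (x + 1)) := by
      field_simp
    rw [this, one_le_div (by positivity)]
    refine le_trans ?_ (mul_le_mul_of_nonneg_right hB (by positivity))
    have : (1 + a * x⁻¹) * (s + (x + 1)) = s + x + 1 + a + a * (s + 1) / x := by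
      field_simp
      ring
    rw [this]
    have : 0 ≤ a * (s + 1) / x := by positivity
    linarith
  have hlim : Filter.Tendsto (fun m : ℕ => GammaSeq (s + a) (m + 1) / GammaSeq s (m + 1))
      Filter.atTop (nhds (Gamma (s + a) / Gamma s)) :=
    (((GammaSeq_tendsto_Gamma _).div (GammaSeq_tendsto_Gamma _) (Gamma_pos_of_pos hs).ne').comp
      (Filter.tendsto_add_atTop_nat 1))
  obtain ⟨m, rfl⟩ := Nat.exists_eq_succ_of_ne_zero hn
  exact hmono.ge_of_tendsto hlim m

theorem summable_pow_div_Gamma_s17 {β η : ℝ} (hβ : 1 ≤ β) (hη : 1 ≤ η) (t : ℝ) :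
    Summable fun n : ℕ => t ^ n / Gamma (β * n + η) := by
  refine Summable.of_norm_bounded_eventually_nat (Real.summable_pow_div_factorial |t|) ?_
  filter_upwards [Filter.eventually_ge_atTop 1] with n hn
  have hn' : (1 : ℝ) ≤ n := by exact_mod_cast hn
  have h1 : (n + 1 : ℝ) ≤ β * n + η := by nlinarith
  have h2 : (n.factorial : ℝ) ≤ Gamma (β * n + η) := by
    rw [← Real.Gamma_nat_eq_factorial]
    exact Gamma_strictMonoOn_Ici.monotoneOn (Set.mem_Ici.2 (by linarith))
      (Set.mem_Ici.2 (by linarith)) h1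
  rw [norm_div, norm_pow, Real.norm_eq_abs, Real.norm_of_nonneg
    (Gamma_nonneg_of_nonneg (by linarith))]
  gcongr

theorem GammaSeq_div_GammaSeq_eq {β η : ℝ} (hβ : 0 ≤ β) (hη : 0 < η) {N : ℕ} (hN : N ≠ 0)
    (n : ℕ) :
    GammaSeq (2 * n + 3) N / GammaSeq (β * n + η) N = (N : ℝ) ^ (3 - η) *
      ((N : ℝ) ^ (2 - β)) ^ n *
      ∏ j ∈ Finset.range (N + 1), (β * n + η + j) / (2 * n + 3 + j) := by
  have h0 : (0 : ℝ) < N := by positivity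
  have h1 : (N : ℝ) ^ (2 * n + 3 : ℝ) =
      (N : ℝ) ^ (3 - η) * ((N : ℝ) ^ (2 - β)) ^ n * (N : ℝ) ^ (β * n + η) := by
    rw [← rpow_mul_natCast h0.le, ← rpow_add h0, ← rpow_add h0]
    congr 1
    ring
  have h2 : 0 < ∏ j ∈ Finset.range (N + 1), (β * n + η + j) :=
    Finset.prod_pos fun j _ => by positivity
  have h3 : 0 < ∏ j ∈ Finset.range (N + 1), (2 * n + 3 + j : ℝ) :=
    Finset.prod_pos fun j _ => by positivity
  unfold GammaSeq
  rw [h1, Finset.prod_div_distrib]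
  have h4 : (0 : ℝ) < (N : ℝ) ^ (β * n + η) := by positivity
  have h5 : (0 : ℝ) < N.factorial := by positivity
  field_simp

open Filter Topology in
/-- With the factor of index `1` of Euler's product left out, the limit is still nonnegative. -/
theorem tsum_div_Gamma_mul_nonneg {β η : ℝ} (hβ1 : 1 < β) (hβ2 : β < 2)
    (hη : (3 / 2) * β ≤ η) {t : ℝ} (ht : 0 ≤ t)
    (hsum : Summable fun n : ℕ =>
      (2 * n + 4) / (β * n + η + 1) * ((-1) ^ n / Gamma (β * n + η)) * t ^ n) :
    0 ≤ ∑' n : ℕ, (2 * n + 4) / (β * n + η + 1) * ((-1) ^ n / Gamma (β * n + η)) * t ^ n := by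
  have hη0 : 0 < η := by linarith
  have hs : ∀ n : ℕ, 0 < β * n + η := fun n => by positivity
  let R : ℕ → ℕ → ℝ := fun N n => GammaSeq (2 * n + 3) N / GammaSeq (β * n + η) N /
    (Gamma (2 * n + 3) / Gamma (β * n + η))
  have hG : ∀ n : ℕ, 0 < Gamma (2 * n + 3) / Gamma (β * n + η) := fun n =>
    div_pos (Gamma_pos_of_pos (by positivity)) (Gamma_pos_of_pos (hs n))
  have hR : ∀ n, Tendsto (fun N => R N n) atTop (𝓝 1) := fun n => by
    have := ((GammaSeq_tendsto_Gamma (2 * n + 3)).div (GammaSeq_tendsto_Gamma (β * n + η))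
      (Gamma_pos_of_pos (hs n)).ne').div_const (Gamma (2 * n + 3) / Gamma (β * n + η))
    rwa [div_self (hG n).ne'] at this
  have hRnonneg : ∀ N, N ≠ 0 → ∀ n, 0 ≤ R N n := fun N hN n =>
    div_nonneg (div_nonneg (GammaSeq_pos (by positivity) hN).le (GammaSeq_pos (hs n) hN).le)
      (hG n).le
  have hRle : ∀ᶠ N in atTop, ∀ n, R N n ≤ 2 := by
    obtain ⟨M, hM⟩ := exists_nat_ge ((η - 2) / (2 - β))
    have hM' : η - 2 ≤ M * (2 - β) := (div_le_iff₀ (by linarith)).1 hM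
    have hfin : ∀ᶠ N in atTop, ∀ n ∈ Set.Iio M, R N n ≤ 2 :=
      (eventually_all_finite (Set.finite_Iio M)).2 fun n _ =>
        (hR n).eventually (eventually_le_nhds one_lt_two)
    filter_upwards [hfin, eventually_ne_atTop 0] with N hN hN0 n
    rcases lt_or_ge n M with hn | hn
    · exact hN n hn
    · have hnM : (M : ℝ) ≤ n := by exact_mod_cast hn
      have ha : 1 ≤ 2 * n + 3 - (β * n + η) := by nlinarith
      have := GammaSeq_div_GammaSeq_le (hs n) ha hN0
      rw [add_sub_cancel] at this
      exact ((div_le_one (hG n)).2 this).trans one_le_two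
  have hlim : Tendsto (fun N => ∑' n : ℕ,
      (2 * n + 4) / (β * n + η + 1) * ((-1) ^ n / Gamma (β * n + η)) * t ^ n * R N n) atTop
      (𝓝 (∑' n : ℕ, (2 * n + 4) / (β * n + η + 1) * ((-1) ^ n / Gamma (β * n + η)) * t ^ n)) := by
    refine tendsto_tsum_of_dominated_convergence (hsum.norm.mul_right 2) (fun n => ?_) ?_
    · simpa using (hR n).const_mul
        ((2 * n + 4) / (β * n + η + 1) * ((-1) ^ n / Gamma (β * n + η)) * t ^ n)
    · filter_upwards [hRle, eventually_ne_atTop 0] with N hN hN0 n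
      rw [norm_mul, norm_of_nonneg (hRnonneg N hN0 n)]
      exact mul_le_mul_of_nonneg_left (hN n) (norm_nonneg _)
  refine ge_of_tendsto hlim ?_
  filter_upwards [eventually_ne_atTop 0] with N hN
  have hN0 : (0 : ℝ) < N := by positivity
  have key := (summable_and_tsum_prod_nonneg (by linarith) hβ2.le hη
    ((Finset.range (N + 1)).erase 1)).2 ((N : ℝ) ^ (2 - β) * t) (by positivity)
  have heq : ∀ n : ℕ,
      (2 * n + 4) / (β * n + η + 1) * ((-1) ^ n / Gamma (β * n + η)) * t ^ n * R N n =
      (N : ℝ) ^ (3 - η) * ((∏ j ∈ (Finset.range (N + 1)).erase 1,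
        (β * n + η + j) / (2 * n + 3 + j)) *
      ((-1) ^ n / ((2 * n + 2).factorial : ℝ)) * ((N : ℝ) ^ (2 - β) * t) ^ n) := by
    intro n
    have h1 : (2 * n + 3 : ℝ) = ((2 * n + 2 : ℕ) : ℝ) + 1 := by push_cast; ring
    simp only [R]
    rw [GammaSeq_div_GammaSeq_eq (by linarith) hη0 hN,
      ← Finset.mul_prod_erase _ _ (Finset.mem_range.2 (by omega : 1 < N + 1)),
      show Gamma (2 * n + 3) = ((2 * n + 2).factorial : ℝ) by rw [h1, Gamma_nat_eq_factorial],
      mul_pow, Nat.cast_one, show (2 * n + 3 + 1 : ℝ) = 2 * n + 4 by ring]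
    have h2 := Gamma_pos_of_pos (hs n)
    have h3 : 0 < β * n + η + 1 := by linarith [hs n]
    generalize ∏ j ∈ (Finset.range (N + 1)).erase 1, (β * n + η + j) / (2 * n + 3 + j : ℝ) = P
    field_simp
  simp only [heq, tsum_mul_left]
  positivity

theorem pskhu_positivity (β η : ℝ) (hβ1 : 1 < β) (hβ2 : β < 2) (hη : (3 / 2) * β ≤ η) :
    ∀ t : ℝ, 0 ≤ t → 0 < mittagLeffler β η (-t) := by
  intro t ht
  have hη0 : 0 < η := by linarith
  have hs : ∀ n : ℕ, 0 < β * n + η := fun n => by positivity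
  have hη1 : 1 ≤ η := by linarith
  let a : ℕ → ℝ := fun n => (2 * n + 4) / (β * n + η + 1) * ((-1) ^ n / Gamma (β * n + η))
  have ha : ∀ t : ℝ, Summable fun n => a n * t ^ n := fun t => by
    refine Summable.of_norm_bounded
      ((summable_pow_div_Gamma_s17 hβ1.le hη1 t).norm.mul_left 4) fun n => ?_
    have h1 : ‖(2 * n + 4) / (β * n + η + 1)‖ ≤ 4 := by
      have := hs n
      rw [norm_of_nonneg (by positivity), div_le_iff₀ (by positivity)]
      have : (0 : ℝ) ≤ n := n.cast_nonneg
      nlinarith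
    have h2 : a n * t ^ n =
        (2 * n + 4) / (β * n + η + 1) * ((-1) ^ n * (t ^ n / Gamma (β * n + η))) := by
      simp only [a]; ring
    rw [h2, norm_mul, norm_mul ((-1) ^ n), norm_pow, norm_neg, norm_one, one_pow, one_mul]
    gcongr
  have hpos : ∀ t : ℝ, 0 ≤ t → 0 ≤ ∑' n, a n * t ^ n := fun t ht =>
    tsum_div_Gamma_mul_nonneg hβ1 hβ2 hη ht (ha t)
  have ha0 : 0 < a 0 := by
    have := Gamma_pos_of_pos hη0
    simp only [a, Nat.cast_zero, mul_zero, zero_add, pow_zero]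
    positivity
  have key := hasSum_add_div_mul ha (β / 2) (1 + η - 2 * β) 3 t
  have heq : mittagLeffler β η (-t) = ∑' n : ℕ,
      (β / 2 + (1 + η - 2 * β) / (2 * n + (3 : ℕ) + 1)) * a n * t ^ n := by
    refine tsum_congr fun n => ?_
    have h2 := Gamma_pos_of_pos (hs n)
    have h3 : 0 < β * n + η + 1 := by linarith [hs n]
    rw [neg_pow]
    simp only [a]
    have h4 : (2 * n + (3 : ℕ) + 1 : ℝ) = 2 * n + 4 := by push_cast; ring
    have h5 : (2 * n + 4 : ℝ) ≠ 0 := by positivity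
    have h6 : β / 2 + (1 + η - 2 * β) / (2 * n + 4) = (β * n + η + 1) / (2 * n + 4) := by
      field_simp
      ring
    rw [h4, h6]
    field_simp
  rw [heq, key.tsum_eq]
  exact add_pos_of_nonneg_of_pos (mul_nonneg (by positivity) (hpos t ht))
    (mul_pos (by linarith) (integral_pow_mul_tsum_pos ha hpos ha0 3 ht))
end
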